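/- arXiv:1809.01719 — 2 statements merged into one kernel-verified Lean document; each statement's English description precedes it below -/
import Mathlib

section
/- Let g(y) = 𝔞·e^{βy} + 𝔟 on ℤ with 𝔞, β > 0, 𝔟 ≥ 0, and p = 1. Let m: ℤ → ℕ be finitely supported and σ: ℤ → ℝ satisfy σ_{i−1} − σ_i = β·m_i for all i ∈ ℤ, with σ_i > ln 𝔟 for all i. Then for every bounded cylinder function φ: ∫Lφ dν^{σ,m} = Σ_{i∈ℤ} (e^{β m_i} − 1)·(e^{σ_i} − 𝔟)·[∫φ dν^{σ^{(i)}, m^{i,i+1}} − ∫φ dν^{σ,m}], where m^{i,i+1} denotes m with m_i decreased by 1 and m_{i+1} increased by 1, and σ^{(i)} agrees with σ except that σ^{(i)}_i = σ_i + β. (The sum is effectively finite since terms with m_i = 0 vanish.) -/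
open MeasureTheory Real

noncomputable def gfactZ (g : ℤ → ℝ) (z : ℤ) : ℝ :=
  if 0 ≤ z then ∏ y ∈ Finset.Icc 1 z, g y else (∏ y ∈ Finset.Icc (z + 1) 0, g y)⁻¹

noncomputable def ZZ (g : ℤ → ℝ) (θ : ℝ) : ℝ := ∑' z : ℤ, exp (θ * z) / gfactZ g z

noncomputable def muZ (g : ℤ → ℝ) (θ : ℝ) (z : ℤ) : ℝ := exp (θ * z) / (gfactZ g z * ZZ g θ)

abbrev ConfZ : Type := ℤ → ℤ

/-- The configuration with one particle moved from site `i` to site `j`. -/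
def moveZ (η : ConfZ) (i j : ℤ) : ConfZ :=
  fun k => if k = i then η k - 1 else if k = j then η k + 1 else η k

/-- The coupled totally asymmetric (`p = 1`) zero range generator with rate function `g`. -/
noncomputable def LZ (g : ℤ → ℝ) (φ : ConfZ × ConfZ → ℝ) (x : ConfZ × ConfZ) : ℝ :=
  ∑' i : ℤ,
    (g (x.1 i) * (φ (moveZ x.1 i (i + 1), moveZ x.2 i (i + 1)) - φ x)
      + (g (x.2 i) - g (x.1 i)) * (φ (x.1, moveZ x.2 i (i + 1)) - φ x))

/-- A bounded cylinder function: bounded and depending on finitely many coordinates. -/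
def IsBddCylinderZ (φ : ConfZ × ConfZ → ℝ) : Prop :=
  (∃ s : Finset ℤ, ∀ x y : ConfZ × ConfZ,
      (∀ i ∈ s, x.1 i = y.1 i ∧ x.2 i = y.2 i) → φ x = φ y)
    ∧ ∃ C : ℝ, ∀ x, |φ x| ≤ C

/-- The discrete measure on ℤ × ℤ with mass function `f`. -/
noncomputable def siteMeasureZ (f : ℤ × ℤ → ℝ) : Measure (ℤ × ℤ) :=
  Measure.count.withDensity fun yz => ENNReal.ofReal (f yz)

/-- `ν` is the product measure on `(ℤ × ℤ)^ℤ` with the given site marginals: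
every cylinder event has product probability. -/
def IsProductMeasureZ (fac : ℤ → Measure (ℤ × ℤ)) (ν : Measure (ConfZ × ConfZ)) : Prop :=
  ∀ (s : Finset ℤ) (B : ℤ → Set (ℤ × ℤ)),
    ν {x : ConfZ × ConfZ | ∀ i ∈ s, (x.1 i, x.2 i) ∈ B i} = ∏ i ∈ s, fac i (B i)

/-- The site marginals of the multi-shock measure `ν^{σ,m}`: at site `i`, the image of
`μ^{σ_i}` under `y ↦ (y, y + m_i)`. -/
noncomputable def multiFactorZ (g : ℤ → ℝ) (σ : ℤ → ℝ) (m : ℤ → ℕ) (i : ℤ) :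
    Measure (ℤ × ℤ) :=
  siteMeasureZ fun yz => if yz.2 = yz.1 + (m i : ℤ) then muZ g (σ i) yz.1 else 0

/-- The number-of-second-class-particles configuration with one particle moved from `i` to `j`. -/
def moveM (m : ℤ → ℕ) (i j : ℤ) : ℤ → ℕ :=
  fun k => if k = i then m k - 1 else if k = j then m k + 1 else m k

open Filter Topology

lemma gfactZ_pos (g : ℤ → ℝ) (hg : ∀ z, 0 < g z) (z : ℤ) : 0 < gfactZ g z := by
  unfold gfactZ
  split_ifs
  · exact Finset.prod_pos fun y _ => hg y
  · exact inv_pos.2 (Finset.prod_pos fun y _ => hg y)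

lemma gfactZ_step (g : ℤ → ℝ) (hg : ∀ z, 0 < g z) (z : ℤ) :
    gfactZ g z = gfactZ g (z - 1) * g z := by
  unfold gfactZ
  rcases lt_trichotomy z 0 with h | h | h
  · rw [if_neg (by omega), if_neg (by omega)]
    have : Finset.Icc (z - 1 + 1) 0 = insert z (Finset.Icc (z + 1) 0) := by
      ext x; simp only [Finset.mem_Icc, Finset.mem_insert]; omega
    rw [this, Finset.prod_insert (by simp), mul_inv]
    have := (hg z).ne'
    field_simp
  · subst h
    have := (hg 0).ne'
    simp [this]
  · rw [if_pos (by omega), if_pos (by omega)]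
    have : Finset.Icc 1 z = insert z (Finset.Icc 1 (z - 1)) := by
      ext x; simp only [Finset.mem_Icc, Finset.mem_insert]; omega
    rw [this, Finset.prod_insert (by simp), mul_comm]

/-- unnormalised weight -/
noncomputable def wZ (g : ℤ → ℝ) (θ : ℝ) (z : ℤ) : ℝ := exp (θ * z) / gfactZ g z

lemma wZ_pos (g : ℤ → ℝ) (hg : ∀ z, 0 < g z) (θ : ℝ) (z : ℤ) : 0 < wZ g θ z :=
  div_pos (exp_pos _) (gfactZ_pos g hg z)

lemma wZ_step (g : ℤ → ℝ) (hg : ∀ z, 0 < g z) (θ : ℝ) (z : ℤ) :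
    g z * wZ g θ z = exp θ * wZ g θ (z - 1) := by
  unfold wZ
  rw [gfactZ_step g hg z]
  have h1 := (hg z).ne'
  have h2 := (gfactZ_pos g hg (z - 1)).ne'
  have : exp (θ * z) = exp θ * exp (θ * ((z - 1 : ℤ) : ℝ)) := by
    rw [← exp_add]; congr 1; push_cast; ring
  rw [this]
  field_simp

lemma wZ_summable (𝔞 β 𝔟 : ℝ) (h𝔞 : 0 < 𝔞) (hβ : 0 < β) 
    (g : ℤ → ℝ) (hg : ∀ y : ℤ, g y = 𝔞 * exp (β * y) + 𝔟) (hgp : ∀ z, 0 < g z)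
    (θ : ℝ) (hθ : 𝔟 < exp θ) : Summable (wZ g θ) := by
  have hlin : Tendsto (fun n : ℕ => β * (n : ℝ)) atTop atTop :=
    tendsto_natCast_atTop_atTop.const_mul_atTop hβ
  have hpos : ∀ z, ‖wZ g θ z‖ = wZ g θ z := fun z => by
    rw [Real.norm_eq_abs, abs_of_pos (wZ_pos g hgp θ z)]
  apply Summable.of_nat_of_neg
  · apply summable_of_ratio_test_tendsto_lt_one (l := 0) one_pos
    · exact Eventually.of_forall fun n => (wZ_pos g hgp θ _).ne'
    · have h1 : Tendsto (fun n : ℕ => g ((n + 1 : ℕ) : ℤ)) atTop atTop := by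
        simp only [hg]
        apply tendsto_atTop_add_const_right
        apply Tendsto.const_mul_atTop h𝔞
        apply tendsto_exp_atTop.comp
        exact hlin.comp (tendsto_add_atTop_nat 1)
      refine (h1.const_div_atTop (exp θ)).congr fun n => ?_
      have := wZ_step g hgp θ ((n + 1 : ℕ) : ℤ)
      rw [hpos, hpos]
      have h2 : (((n + 1 : ℕ) : ℤ) - 1) = (n : ℤ) := by push_cast; ring
      rw [h2] at this
      rw [div_eq_div_iff (hgp _).ne' (wZ_pos g hgp θ _).ne', ← this]
      ring
  · apply summable_of_ratio_test_tendsto_lt_one (l := 𝔟 / exp θ)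
    · rwa [div_lt_one (exp_pos _)]
    · exact Eventually.of_forall fun n => (wZ_pos g hgp θ _).ne'
    · have h1 : Tendsto (fun n : ℕ => g (-(n : ℤ))) atTop (𝓝 𝔟) := by
        simp only [hg]
        have : Tendsto (fun n : ℕ => 𝔞 * exp (-(β * (n : ℝ))) + 𝔟) atTop (𝓝 (𝔞 * 0 + 𝔟)) := by
          apply Tendsto.add_const
          apply Tendsto.const_mul
          exact tendsto_exp_neg_atTop_nhds_zero.comp hlin
        simpa using this
      refine (h1.div_const (exp θ)).congr fun n => ?_
      have := wZ_step g hgp θ (-(n : ℤ))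
      rw [hpos, hpos]
      have h2 : (-(n : ℤ) - 1) = -((n + 1 : ℕ) : ℤ) := by push_cast; ring
      rw [h2] at this
      rw [div_eq_div_iff (exp_pos _).ne' (wZ_pos g hgp θ _).ne', this]
      ring

lemma ZZ_pos (g : ℤ → ℝ) (hgp : ∀ z, 0 < g z) (θ : ℝ) (hs : Summable (wZ g θ)) : 0 < ZZ g θ :=
  hs.tsum_pos (fun z => (wZ_pos g hgp θ z).le) 0 (wZ_pos g hgp θ 0)

lemma muZ_eq (g : ℤ → ℝ) (θ : ℝ) (z : ℤ) : muZ g θ z = wZ g θ z / ZZ g θ := by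
  unfold muZ wZ; rw [div_div]

lemma muZ_pos (g : ℤ → ℝ) (hgp : ∀ z, 0 < g z) (θ : ℝ) (hs : Summable (wZ g θ)) (z : ℤ) :
    0 < muZ g θ z := by
  rw [muZ_eq]; exact div_pos (wZ_pos g hgp θ z) (ZZ_pos g hgp θ hs)

lemma muZ_hasSum (g : ℤ → ℝ) (hgp : ∀ z, 0 < g z) (θ : ℝ) (hs : Summable (wZ g θ)) :
    HasSum (muZ g θ) 1 := by
  have h : HasSum (wZ g θ) (ZZ g θ) := hs.hasSum
  have := h.div_const (ZZ g θ)
  rw [div_self (ZZ_pos g hgp θ hs).ne'] at this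
  exact this.congr_fun (fun z => muZ_eq g θ z)

lemma muZ_step (g : ℤ → ℝ) (hg : ∀ z, 0 < g z) (θ : ℝ) (z : ℤ) :
    g z * muZ g θ z = exp θ * muZ g θ (z - 1) := by
  rw [muZ_eq, muZ_eq, ← mul_div_assoc, wZ_step g hg, mul_div_assoc]

lemma muZ_tilt (𝔞 β 𝔟 : ℝ)
    (g : ℤ → ℝ) (hg : ∀ y : ℤ, g y = 𝔞 * exp (β * y) + 𝔟) (hgp : ∀ z, 0 < g z)
    (θ : ℝ) (hs : Summable (wZ g θ)) (hs' : Summable (wZ g (θ + β))) (z : ℤ) :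
    (g z - 𝔟) * muZ g θ z = (exp θ - 𝔟) * muZ g (θ + β) z := by
  have hZ := (ZZ_pos g hgp θ hs).ne'
  have hZ' := (ZZ_pos g hgp _ hs').ne'
  have key : ∀ z, (g z - 𝔟) * muZ g θ z
      = (𝔞 * ZZ g (θ + β) / ZZ g θ) * muZ g (θ + β) z := by
    intro z
    rw [muZ_eq, muZ_eq]
    have : wZ g (θ + β) z = exp (β * z) * wZ g θ z := by
      unfold wZ
      rw [add_mul, exp_add]; ring
    rw [this, hg]
    field_simp
    ring
  have s1 : HasSum (fun z => (g z - 𝔟) * muZ g θ z) (𝔞 * ZZ g (θ + β) / ZZ g θ) := by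
    have := (muZ_hasSum g hgp _ hs').mul_left (𝔞 * ZZ g (θ + β) / ZZ g θ)
    rw [mul_one] at this
    exact this.congr_fun key
  have s2 : HasSum (fun z => (g z - 𝔟) * muZ g θ z) (exp θ - 𝔟) := by
    have h1 := muZ_hasSum g hgp _ hs
    have h2 : HasSum (fun z => muZ g θ (z - 1)) 1 :=
      ((Equiv.subRight (1 : ℤ)).hasSum_iff (f := muZ g θ)).2 h1
    have h3 := (h2.mul_left (exp θ)).sub (h1.mul_left 𝔟)
    rw [mul_one, mul_one] at h3
    refine h3.congr_fun fun z => ?_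
    rw [sub_mul, muZ_step g hgp]
  rw [key, s1.unique s2]
open scoped ENNReal

/-- the single-site measure -/
noncomputable def muM (g : ℤ → ℝ) (θ : ℝ) : Measure ℤ :=
  Measure.count.withDensity fun z => ENNReal.ofReal (muZ g θ z)

lemma muM_singleton (g : ℤ → ℝ) (θ : ℝ) (z : ℤ) :
    muM g θ {z} = ENNReal.ofReal (muZ g θ z) := by
  unfold muM
  rw [withDensity_apply _ (measurableSet_singleton z), lintegral_singleton]
  simp

lemma muM_prob (g : ℤ → ℝ) (hgp : ∀ z, 0 < g z) (θ : ℝ) (hs : Summable (wZ g θ)) :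
    IsProbabilityMeasure (muM g θ) := by
  constructor
  unfold muM
  have h := muZ_hasSum g hgp θ hs
  rw [withDensity_apply _ MeasurableSet.univ, Measure.restrict_univ, lintegral_count,
    ← ENNReal.ofReal_tsum_of_nonneg (fun z => (muZ_pos g hgp θ hs z).le) h.summable, h.tsum_eq]
  simp

lemma infinitePi_tilt (μ : ℤ → Measure ℤ) [∀ i, IsProbabilityMeasure (μ i)] (i : ℤ)
    (μ' : Measure ℤ) [IsProbabilityMeasure μ'] (h : ℤ → ℝ≥0∞) (c : ℝ≥0∞) (hc0 : c ≠ 0)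
    (hct : c ≠ ∞) (hh : (μ i).withDensity h = c • μ') :
    (Measure.infinitePi μ).withDensity (fun ω => h (ω i))
      = c • Measure.infinitePi (Function.update μ i μ') := by
  have hinst : ∀ j, IsProbabilityMeasure (Function.update μ i μ' j) := by
    intro j
    by_cases hj : j = i
    · subst hj; simpa
    · simpa [hj] using (inferInstance : IsProbabilityMeasure (μ j))
  have hmh : Measurable (fun ω : ℤ → ℤ => h (ω i)) :=
    (measurable_of_countable h).comp (measurable_pi_apply i)
  suffices H : c⁻¹ • (Measure.infinitePi μ).withDensity (fun ω => h (ω i))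
      = Measure.infinitePi (Function.update μ i μ') by
    rw [← H, smul_smul, ENNReal.mul_inv_cancel hc0 hct, one_smul]
  apply Measure.eq_infinitePi
  intro s t ht
  -- box away from `i`
  set s' := s.erase i with hs'
  set B : Set ℤ := if i ∈ s then t i else Set.univ with hB
  have hBm : MeasurableSet B := MeasurableSet.of_discrete
  have hbox : MeasurableSet (Set.pi (s' : Set ℤ) t) :=
    MeasurableSet.pi (Finset.countable_toSet _) fun j _ => ht j
  have hset : Set.pi (s : Set ℤ) t = (fun ω : ℤ → ℤ => ω i) ⁻¹' B ∩ Set.pi (s' : Set ℤ) t := by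
    ext ω
    simp only [Set.mem_pi, Finset.mem_coe, Set.mem_inter_iff, Set.mem_preimage, hs',
      Finset.mem_erase, hB]
    constructor
    · intro H
      refine ⟨?_, fun j hj => H j hj.2⟩
      split_ifs with hi
      · exact H i hi
      · trivial
    · rintro ⟨H1, H2⟩ j hj
      by_cases hji : j = i
      · subst hji; simpa [hj] using H1
      · exact H2 j ⟨hji, hj⟩
  set K : ℝ≥0∞ := ∏ j ∈ s', μ j (t j) with hK
  have hmap : ((Measure.infinitePi μ).restrict (Set.pi (s' : Set ℤ) t)).map (fun ω => ω i)
      = K • μ i := by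
    ext A hA
    rw [Measure.map_apply (measurable_pi_apply i) hA, Measure.restrict_apply
      (measurable_pi_apply i hA)]
    have : (fun ω : ℤ → ℤ => ω i) ⁻¹' A ∩ Set.pi (s' : Set ℤ) t
        = Set.pi ((insert i s' : Finset ℤ) : Set ℤ) (Function.update t i A) := by
      ext ω
      simp only [Set.mem_inter_iff, Set.mem_preimage, Set.mem_pi, Finset.mem_coe,
        Finset.mem_insert, hs', Finset.mem_erase]
      constructor
      · rintro ⟨H1, H2⟩ j hj
        by_cases hji : j = i
        · subst hji; simpa using H1
        · simpa [hji] using H2 j (by tauto)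
      · intro H
        refine ⟨by simpa using H i (Or.inl rfl), fun j hj => ?_⟩
        simpa [hj.1] using H j (Or.inr hj)
    rw [this, Measure.infinitePi_pi _ (fun _ _ => MeasurableSet.of_discrete),
      Finset.prod_insert (by simp [hs'])]
    simp only [Function.update_self, Measure.smul_apply, smul_eq_mul]
    rw [mul_comm, hK]
    congr 1
    refine Finset.prod_congr rfl fun j hj => ?_
    rw [Function.update_of_ne (by rintro rfl; simp [hs'] at hj)]
  have hmain : (Measure.infinitePi μ).withDensity (fun ω => h (ω i)) (Set.pi (s : Set ℤ) t)
      = K * (c * μ' B) := by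
    rw [hset, withDensity_apply _ ((measurable_pi_apply i hBm).inter hbox),
      ← Measure.restrict_restrict (measurable_pi_apply i hBm)]
    have := setLIntegral_map (μ := (Measure.infinitePi μ).restrict (Set.pi (s' : Set ℤ) t))
      hBm (measurable_of_countable h) (measurable_pi_apply i)
    rw [← this, hmap, Measure.restrict_smul, lintegral_smul_measure,
      ← withDensity_apply _ hBm, hh]
    simp
  rw [Measure.smul_apply, hmain, smul_eq_mul]
  have : c⁻¹ * (K * (c * μ' B)) = (c⁻¹ * c) * (K * μ' B) := by ring
  rw [this, ENNReal.inv_mul_cancel hc0 hct, one_mul, hK]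
  have hp : ∏ j ∈ s', μ j (t j) = ∏ j ∈ s', Function.update μ i μ' j (t j) := by
    refine Finset.prod_congr rfl fun j hj => ?_
    rw [Function.update_of_ne (by rintro rfl; simp [hs'] at hj)]
  rw [hp]
  by_cases hi : i ∈ s
  · rw [← Finset.prod_erase_mul s _ hi]
    simp [hB, hi, hs']
  · simp [hB, hi, hs']

lemma integral_tilt (μ : ℤ → Measure ℤ) [∀ i, IsProbabilityMeasure (μ i)] (i : ℤ)
    (μ' : Measure ℤ) [IsProbabilityMeasure μ'] (h : ℤ → ℝ) (h0 : ∀ z, 0 ≤ h z)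
    (c : ℝ) (hc : 0 < c)
    (hh : ∀ z, ENNReal.ofReal (h z) * μ i {z} = ENNReal.ofReal c * μ' {z})
    (F : (ℤ → ℤ) → ℝ) (hF : Measurable F) (C : ℝ) (hC : ∀ ω, |F ω| ≤ C) :
    Integrable (fun ω => h (ω i) * F ω) (Measure.infinitePi μ) ∧
    ∫ ω, h (ω i) * F ω ∂(Measure.infinitePi μ)
      = c * ∫ ω, F ω ∂(Measure.infinitePi (Function.update μ i μ')) := by
  have hinst : ∀ j, IsProbabilityMeasure (Function.update μ i μ' j) := by
    intro j
    by_cases hj : j = i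
    · subst hj; simpa
    · simpa [hj] using (inferInstance : IsProbabilityMeasure (μ j))
  have hmh : Measurable (fun ω : ℤ → ℤ => (h (ω i)).toNNReal) :=
    (measurable_of_countable fun z => (h z).toNNReal).comp (measurable_pi_apply i)
  have hd : (μ i).withDensity (fun z => ENNReal.ofReal (h z)) = ENNReal.ofReal c • μ' := by
    apply Measure.ext_of_singleton
    intro z
    rw [withDensity_apply _ (measurableSet_singleton z), lintegral_singleton, hh]
    simp
  have key := infinitePi_tilt μ i μ' _ _ (by simpa using hc) ENNReal.ofReal_ne_top hd
  have hsm : (fun ω : ℤ → ℤ => h (ω i) * F ω) = fun ω => (h (ω i)).toNNReal • F ω := by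
    ext ω
    rw [NNReal.smul_def, smul_eq_mul, Real.coe_toNNReal _ (h0 _)]
  rw [hsm]
  constructor
  · rw [← integrable_withDensity_iff_integrable_smul hmh]
    change Integrable F ((Measure.infinitePi μ).withDensity fun ω => ENNReal.ofReal (h (ω i)))
    rw [key]
    apply Integrable.smul_measure _ ENNReal.ofReal_ne_top
    exact Integrable.of_bound hF.aestronglyMeasurable C (Eventually.of_forall hC)
  · rw [← integral_withDensity_eq_integral_smul hmh]
    change ∫ ω, F ω ∂((Measure.infinitePi μ).withDensity fun ω => ENNReal.ofReal (h (ω i))) = _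
    rw [key, integral_smul_measure, ENNReal.toReal_ofReal hc.le, smul_eq_mul]

lemma multiFactorZ_eq (g : ℤ → ℝ) (σ : ℤ → ℝ) (m : ℤ → ℕ) (i : ℤ) :
    multiFactorZ g σ m i = (muM g (σ i)).map (fun y => (y, y + (m i : ℤ))) := by
  apply Measure.ext_of_singleton
  rintro ⟨y, z⟩
  rw [Measure.map_apply (measurable_of_countable _) (measurableSet_singleton _)]
  unfold multiFactorZ siteMeasureZ
  rw [withDensity_apply _ (measurableSet_singleton _), lintegral_singleton]
  by_cases h : z = y + (m i : ℤ)
  · have : (fun y => (y, y + (m i : ℤ))) ⁻¹' {(y, z)} = {y} := by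
      ext w
      simp only [Set.mem_preimage, Set.mem_singleton_iff, Prod.mk.injEq]
      constructor
      · exact fun h => h.1
      · rintro rfl; exact ⟨rfl, h.symm⟩
    rw [this, muM_singleton]
    simp [h]
  · have : (fun y => (y, y + (m i : ℤ))) ⁻¹' {(y, z)} = ∅ := by
      ext w
      simp only [Set.mem_preimage, Set.mem_singleton_iff, Prod.mk.injEq, Set.mem_empty_iff_false,
        iff_false]
      rintro ⟨rfl, h'⟩
      exact h h'.symm
    rw [this]
    simp [h]

/-- the embedding `ω ↦ (ω, ω + m)` -/
def emb (m : ℤ → ℕ) (ω : ConfZ) : ConfZ × ConfZ := (ω, fun i => ω i + (m i : ℤ))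

lemma measurable_emb (m : ℤ → ℕ) : Measurable (emb m) := by
  unfold emb
  fun_prop

lemma nu_eq (g : ℤ → ℝ) (σ : ℤ → ℝ) (m : ℤ → ℕ)
    (hp : ∀ i, IsProbabilityMeasure (muM g (σ i))) (ν : Measure (ConfZ × ConfZ))
    (hν : IsProductMeasureZ (multiFactorZ g σ m) ν) :
    ν = (Measure.infinitePi (fun i => muM g (σ i))).map (emb m) := by
  let e := MeasurableEquiv.arrowProdEquivProdArrow ℤ ℤ ℤ
  have hmf : ∀ i, Measurable (fun y : ℤ => (y, y + (m i : ℤ))) :=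
    fun i => measurable_of_countable _
  have hp' : ∀ i, IsProbabilityMeasure ((muM g (σ i)).map (fun y => (y, y + (m i : ℤ)))) :=
    fun i => Measure.isProbabilityMeasure_map (hmf i).aemeasurable
  have h1 : ν.map e.symm
      = Measure.infinitePi (fun i => (muM g (σ i)).map (fun y => (y, y + (m i : ℤ)))) := by
    apply Measure.eq_infinitePi
    intro s t ht
    rw [e.symm.map_apply]
    have := hν s t
    simp only [multiFactorZ_eq] at this
    rw [← this]
    rfl
  have h2 := Measure.infinitePi_map_pi (fun i => muM g (σ i)) hmf
  rw [← h2] at h1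
  have h3 : ν = (ν.map e.symm).map e := by simp
  rw [h3, h1, Measure.map_map e.measurable (by fun_prop)]
  rfl

/-- add one particle at `i` -/
def addAt (i : ℤ) (ω : ConfZ) : ConfZ := fun j => if j = i then ω j + 1 else ω j

lemma measurable_addAt (i : ℤ) : Measurable (addAt i) := by
  refine measurable_pi_iff.2 fun j => ?_
  unfold addAt
  split_ifs <;> fun_prop

lemma measurable_moveZ (i j : ℤ) : Measurable (fun ω : ConfZ => moveZ ω i j) := by
  refine measurable_pi_iff.2 fun k => ?_
  unfold moveZ
  split_ifs <;> fun_prop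

lemma integral_g (g : ℤ → ℝ) (hgp : ∀ z, 0 < g z) (σ : ℤ → ℝ)
    (hs : ∀ i, Summable (wZ g (σ i))) (i : ℤ)
    (F : ConfZ → ℝ) (hF : Measurable F) (C : ℝ) (hC : ∀ ω, |F ω| ≤ C) :
    Integrable (fun ω => g (ω i) * F ω) (Measure.infinitePi (fun i => muM g (σ i))) ∧
    ∫ ω, g (ω i) * F ω ∂(Measure.infinitePi (fun i => muM g (σ i)))
      = exp (σ i) * ∫ ω, F (addAt i ω) ∂(Measure.infinitePi (fun i => muM g (σ i))) := by
  have hp : ∀ i, IsProbabilityMeasure (muM g (σ i)) := fun i => muM_prob g hgp _ (hs i)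
  have hms : Measurable (fun y : ℤ => y + 1) := measurable_of_countable _
  have hp' : IsProbabilityMeasure ((muM g (σ i)).map (fun y => y + 1)) :=
    Measure.isProbabilityMeasure_map hms.aemeasurable
  obtain ⟨h1, h2⟩ := integral_tilt (fun i => muM g (σ i)) i ((muM g (σ i)).map (fun y => y + 1))
    g (fun z => (hgp z).le) (exp (σ i)) (exp_pos _) (by
      intro z
      rw [Measure.map_apply hms (measurableSet_singleton _)]
      have : (fun y : ℤ => y + 1) ⁻¹' {z} = {z - 1} := by
        ext w; simp only [Set.mem_preimage, Set.mem_singleton_iff]; omega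
      rw [this, muM_singleton, muM_singleton, ← ENNReal.ofReal_mul (hgp z).le,
        ← ENNReal.ofReal_mul (exp_pos _).le, muZ_step g hgp]) F hF C hC
  refine ⟨h1, ?_⟩
  rw [h2]
  congr 1
  have hmf : ∀ j, Measurable (fun y : ℤ => if j = i then y + 1 else y) :=
    fun i => measurable_of_countable _
  have h3 := Measure.infinitePi_map_pi (fun i => muM g (σ i)) hmf
  have h4 : (fun j => (muM g (σ j)).map (fun y : ℤ => if j = i then y + 1 else y))
      = Function.update (fun i => muM g (σ i)) i ((muM g (σ i)).map (fun y => y + 1)) := by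
    ext1 j
    by_cases hj : j = i
    · subst hj; simp
    · simp [hj]
  rw [← h4, ← h3, integral_map]
  · rfl
  · exact (measurable_addAt i).aemeasurable
  · exact hF.aestronglyMeasurable

lemma integral_g_move (g : ℤ → ℝ) (hgp : ∀ z, 0 < g z) (σ : ℤ → ℝ)
    (hs : ∀ i, Summable (wZ g (σ i))) (i : ℤ)
    (F : ConfZ → ℝ) (hF : Measurable F) (C : ℝ) (hC : ∀ ω, |F ω| ≤ C) :
    ∫ ω, g (ω i) * F (moveZ ω i (i + 1)) ∂(Measure.infinitePi (fun i => muM g (σ i)))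
      = exp (σ i - σ (i + 1)) *
        ∫ ω, g (ω (i + 1)) * F ω ∂(Measure.infinitePi (fun i => muM g (σ i))) := by
  rw [(integral_g g hgp σ hs i (fun ω => F (moveZ ω i (i + 1)))
    (hF.comp (measurable_moveZ _ _)) C (fun ω => hC _)).2,
    (integral_g g hgp σ hs (i + 1) F hF C hC).2, ← mul_assoc, ← exp_add]
  have : ∀ ω, moveZ (addAt i ω) i (i + 1) = addAt (i + 1) ω := by
    intro ω; ext j
    unfold moveZ addAt
    split_ifs <;> omega
  simp only [this]
  congr 2; ring

lemma integral_g_tilt (𝔞 β 𝔟 : ℝ)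
    (g : ℤ → ℝ) (hg : ∀ y : ℤ, g y = 𝔞 * exp (β * y) + 𝔟) (hgp : ∀ z, 0 < g z)
    (hgb : ∀ z, 𝔟 ≤ g z) (σ : ℤ → ℝ) (hσb : ∀ i, 𝔟 < exp (σ i))
    (hs : ∀ i, Summable (wZ g (σ i))) (i : ℤ) (hs' : Summable (wZ g (σ i + β)))
    (F : ConfZ → ℝ) (hF : Measurable F) (C : ℝ) (hC : ∀ ω, |F ω| ≤ C) :
    ∫ ω, (g (ω i) - 𝔟) * F ω ∂(Measure.infinitePi (fun i => muM g (σ i)))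
      = (exp (σ i) - 𝔟) *
        ∫ ω, F ω ∂(Measure.infinitePi (fun j => muM g (Function.update σ i (σ i + β) j))) := by
  have hp : ∀ i, IsProbabilityMeasure (muM g (σ i)) := fun i => muM_prob g hgp _ (hs i)
  have hp' : IsProbabilityMeasure (muM g (σ i + β)) := muM_prob g hgp _ hs'
  have h4 : (fun j => muM g (Function.update σ i (σ i + β) j))
      = Function.update (fun i => muM g (σ i)) i (muM g (σ i + β)) := by
    ext1 j
    by_cases hj : j = i
    · subst hj; simp
    · simp [hj]
  rw [h4]
  refine (integral_tilt (fun i => muM g (σ i)) i (muM g (σ i + β)) (fun z => g z - 𝔟)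
    (fun z => sub_nonneg.2 (hgb z)) (exp (σ i) - 𝔟) (sub_pos.2 (hσb i)) ?_ F hF C hC).2
  intro z
  rw [muM_singleton, muM_singleton, ← ENNReal.ofReal_mul (sub_nonneg.2 (hgb z)),
        ← ENNReal.ofReal_mul (sub_pos.2 (hσb i)).le, muZ_tilt 𝔞 β 𝔟 g hg hgp _ (hs i) hs']

lemma cyl_measurable (φ : ConfZ × ConfZ → ℝ) (s : Finset ℤ) (h : ∀ x y : ConfZ × ConfZ,
      (∀ i ∈ s, x.1 i = y.1 i ∧ x.2 i = y.2 i) → φ x = φ y) : Measurable φ := by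
  let r : ConfZ × ConfZ → (s → ℤ × ℤ) := fun x i => (x.1 i, x.2 i)
  let ψ : (s → ℤ × ℤ) → ℝ := fun f =>
    φ (fun i => if h : i ∈ s then (f ⟨i, h⟩).1 else 0, fun i => if h : i ∈ s then (f ⟨i, h⟩).2 else 0)
  have hr : Measurable r := by
    refine measurable_pi_iff.2 fun i => ?_
    simp only [r]
    fun_prop
  have : φ = ψ ∘ r := by
    ext x
    apply h
    intro i hi
    simp [hi, r]
  rw [this]
  exact (measurable_of_countable ψ).comp hr
/-- Theorem 2, case (iv): multiple random walking shocks in the generalised exponential zero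
range process. The walker at site `i` jumps to `i + 1` with rate
`(e^{β m_i} - 1)·(e^{σ_i} - 𝔟)`, updating `m` by `m^{i,i+1}` and `σ_i` to `σ_i + β`. -/
theorem rws_multi_generalised_exponential_ZRP
    (𝔞 β 𝔟 : ℝ) (h𝔞 : 0 < 𝔞) (hβ : 0 < β) (h𝔟 : 0 ≤ 𝔟)
    (g : ℤ → ℝ) (hg : ∀ y : ℤ, g y = 𝔞 * exp (β * y) + 𝔟)
    (m : ℤ → ℕ) (hm : (Function.support m).Finite)
    (σ : ℤ → ℝ) (hσ : ∀ i : ℤ, σ (i - 1) - σ i = β * m i)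
    (hσb : ∀ i : ℤ, 𝔟 < exp (σ i))
    (ν : (ℤ → ℝ) → (ℤ → ℕ) → Measure (ConfZ × ConfZ))
    (hν : ∀ (σ' : ℤ → ℝ) (m' : ℤ → ℕ), (Function.support m').Finite →
      (∀ i : ℤ, σ' (i - 1) - σ' i = β * m' i) → (∀ i : ℤ, 𝔟 < exp (σ' i)) →
      IsProductMeasureZ (multiFactorZ g σ' m') (ν σ' m'))
    (φ : ConfZ × ConfZ → ℝ) (hφ : IsBddCylinderZ φ) :
    ∫ x, LZ g φ x ∂(ν σ m)
      = ∑' i : ℤ, (exp (β * m i) - 1) * (exp (σ i) - 𝔟) *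
          ((∫ x, φ x ∂(ν (Function.update σ i (σ i + β)) (moveM m i (i + 1))))
            - ∫ x, φ x ∂(ν σ m)) := by

  classical
  obtain ⟨⟨s, hs⟩, C, hC⟩ := hφ
  have hφm : Measurable φ := cyl_measurable φ s hs
  have hgb : ∀ z, 𝔟 ≤ g z := fun z => by
    rw [hg]; have := mul_pos h𝔞 (exp_pos (β * z)); linarith
  have hgp : ∀ z, 0 < g z := fun z => by
    rw [hg]; have := mul_pos h𝔞 (exp_pos (β * z)); linarith
  have hsum : ∀ θ, 𝔟 < exp θ → Summable (wZ g θ) := fun θ hθ =>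
    wZ_summable 𝔞 β 𝔟 h𝔞 hβ g hg hgp θ hθ
  have hsσ : ∀ i, Summable (wZ g (σ i)) := fun i => hsum _ (hσb i)
  have hbβ : ∀ i, 𝔟 < exp (σ i + β) := fun i =>
    (hσb i).trans (exp_lt_exp.2 (by linarith))
  have hp : ∀ i, IsProbabilityMeasure (muM g (σ i)) := fun i => muM_prob g hgp _ (hsσ i)
  set P := Measure.infinitePi (fun i => muM g (σ i)) with hP
  have hνP : ν σ m = P.map (emb m) := nu_eq g σ m hp _ (hν σ m hm hσ hσb)
  -- the functions on the first marginal
  set Φ : ConfZ → ℝ := fun ω => φ (emb m ω) with hΦ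
  have hΦm : Measurable Φ := hφm.comp (measurable_emb m)
  have hΦC : ∀ ω, |Φ ω| ≤ C := fun ω => hC _
  set D : ℤ → ConfZ → ℝ := fun i ω => φ (ω, moveZ (emb m ω).2 i (i + 1)) with hD
  have hDm : ∀ i, Measurable (D i) := fun i => hφm.comp
    (measurable_id.prodMk ((measurable_moveZ i (i + 1)).comp (measurable_emb m).snd))
  have hDC : ∀ i ω, |D i ω| ≤ C := fun i ω => hC _
  set G : ℤ → ℝ := fun i => ∫ ω, g (ω i) * Φ ω ∂P with hG
  set E : ℝ := ∫ ω, Φ ω ∂P with hE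
  set EE : ℤ → ℝ := fun i =>
    ∫ x, φ x ∂(ν (Function.update σ i (σ i + β)) (moveM m i (i + 1))) with hEE
  have hEν : ∫ x, φ x ∂(ν σ m) = E := by
    rw [hνP, integral_map (measurable_emb m).aemeasurable hφm.aestronglyMeasurable]
  set c : ℤ → ℝ := fun i => exp (β * m i) - 1 with hc
  have hbint : ∀ F : ConfZ → ℝ, Measurable F → (∀ ω, |F ω| ≤ C) → Integrable F P :=
    fun F h1 h2 => Integrable.of_bound h1.aestronglyMeasurable C (Eventually.of_forall h2)
  -- the shifted measures
  have hDE : ∀ i, c i * ∫ ω, (g (ω i) - 𝔟) * D i ω ∂P = c i * ((exp (σ i) - 𝔟) * EE i) := by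
    intro i
    by_cases hmi : m i = 0
    · simp [hc, hmi]
    congr 1
    rw [integral_g_tilt 𝔞 β 𝔟 g hg hgp hgb σ hσb hsσ i (hsum _ (hbβ i)) (D i) (hDm i) C (hDC i)]
    congr 1
    have hub : ∀ j, 𝔟 < exp (Function.update σ i (σ i + β) j) := by
      intro j
      by_cases hj : j = i
      · subst hj; simpa using hbβ j
      · simpa [hj] using hσb j
    have hprod := hν (Function.update σ i (σ i + β)) (moveM m i (i + 1))
      (by
        refine (hm.union (Set.finite_singleton (i + 1))).subset fun j hj => ?_
        simp only [Function.mem_support, moveM] at hj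
        simp only [Set.mem_union, Function.mem_support, Set.mem_singleton_iff]
        by_contra! hcon
        obtain ⟨h1, h2⟩ := hcon
        apply hj
        split_ifs <;> simp_all)
      (by
        intro j
        have h0 := hσ j
        unfold moveM
        by_cases hj : j = i
        · subst hj
          rw [Function.update_self, Function.update_of_ne (by omega), if_pos rfl,
            Nat.cast_sub (by omega)]
          push_cast
          linarith
        · by_cases hj' : j = i + 1
          · subst hj'
            rw [Function.update_of_ne hj, if_neg hj, if_pos rfl]
            have : i + 1 - 1 = i := by ring
            rw [this] at h0 ⊢
            rw [Function.update_self]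
            push_cast
            linarith
          · rw [Function.update_of_ne hj, Function.update_of_ne (by omega), if_neg hj, if_neg hj']
            exact h0)
      hub
    have hp' : ∀ j, IsProbabilityMeasure (muM g (Function.update σ i (σ i + β) j)) :=
      fun j => muM_prob g hgp _ (hsum _ (hub j))
    simp only [hEE]
    rw [nu_eq g _ _ hp' _ hprod,
      integral_map (measurable_emb _).aemeasurable hφm.aestronglyMeasurable]
    refine integral_congr_ae (Eventually.of_forall fun ω => ?_)
    simp only [hD, emb]
    congr 2
    ext j
    unfold moveZ moveM
    split_ifs with h1 h2
    · subst h1; dsimp only; omega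
    · push_cast; ring
    · rfl
  -- the generator, term by term
  set t : ℤ → ConfZ × ConfZ → ℝ := fun i x =>
    (g (x.1 i) * (φ (moveZ x.1 i (i + 1), moveZ x.2 i (i + 1)) - φ x)
      + (g (x.2 i) - g (x.1 i)) * (φ (x.1, moveZ x.2 i (i + 1)) - φ x)) with ht
  have htm : ∀ i, Measurable (t i) := by
    intro i
    have hgm : Measurable g := measurable_of_countable g
    have hm1 : Measurable fun x : ConfZ × ConfZ => moveZ x.1 i (i + 1) :=
      (measurable_moveZ i (i + 1)).comp measurable_fst
    have hm2 : Measurable fun x : ConfZ × ConfZ => moveZ x.2 i (i + 1) :=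
      (measurable_moveZ i (i + 1)).comp measurable_snd
    have hg1 : Measurable fun x : ConfZ × ConfZ => g (x.1 i) := hgm.comp (by fun_prop)
    have hg2 : Measurable fun x : ConfZ × ConfZ => g (x.2 i) := hgm.comp (by fun_prop)
    exact (hg1.mul ((hφm.comp (hm1.prodMk hm2)).sub hφm)).add
      ((hg2.sub hg1).mul ((hφm.comp (measurable_fst.prodMk hm2)).sub hφm))
  have hte : ∀ i ω, t i (emb m ω) = g (ω i) * Φ (moveZ ω i (i + 1)) - g (ω i) * Φ ω
      + c i * ((g (ω i) - 𝔟) * D i ω - g (ω i) * Φ ω + 𝔟 * Φ ω) := by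
    intro i ω
    have h1 : (moveZ (emb m ω).1 i (i + 1), moveZ (emb m ω).2 i (i + 1))
        = emb m (moveZ ω i (i + 1)) := by
      unfold emb
      refine Prod.ext rfl ?_
      ext j
      simp only [moveZ]
      split_ifs <;> ring
    have h2 : g ((emb m ω).2 i) - g ((emb m ω).1 i) = c i * (g (ω i) - 𝔟) := by
      simp only [emb, hg, hc]
      push_cast
      rw [mul_add, exp_add]
      ring
    simp only [ht]
    rw [h1, h2]
    simp only [hD, hΦ]
    simp only [emb]
    ring
  have hint : ∀ i, Integrable (fun ω => t i (emb m ω)) P ∧ ∫ ω, t i (emb m ω) ∂P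
      = exp (β * m (i + 1)) * G (i + 1) - G i
        + c i * ((exp (σ i) - 𝔟) * EE i - G i + 𝔟 * E) := by
    intro i
    have i1 : Integrable (fun ω => g (ω i) * Φ (moveZ ω i (i + 1))) P :=
      (integral_g g hgp σ hsσ i (fun ω => Φ (moveZ ω i (i + 1)))
        (hΦm.comp (measurable_moveZ _ _)) C (fun ω => hΦC _)).1
    have i2 : Integrable (fun ω => g (ω i) * Φ ω) P := (integral_g g hgp σ hsσ i Φ hΦm C hΦC).1
    have i3 : Integrable (fun ω => (g (ω i) - 𝔟) * D i ω) P := by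
      simp only [sub_mul]
      exact (integral_g g hgp σ hsσ i (D i) (hDm i) C (hDC i)).1.sub
        ((hbint _ (hDm i) (hDC i)).const_mul 𝔟)
    have i4 : Integrable (fun ω => 𝔟 * Φ ω) P := (hbint _ hΦm hΦC).const_mul 𝔟
    have i5 : Integrable (fun ω => (g (ω i) - 𝔟) * D i ω - g (ω i) * Φ ω) P := i3.sub i2
    have i6 : Integrable (fun ω => (g (ω i) - 𝔟) * D i ω - g (ω i) * Φ ω + 𝔟 * Φ ω) P := i5.add i4
    have i7 : Integrable (fun ω => g (ω i) * Φ (moveZ ω i (i + 1)) - g (ω i) * Φ ω) P := i1.sub i2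
    simp only [hte]
    refine ⟨i7.add (i6.const_mul _), ?_⟩
    rw [integral_add i7 (i6.const_mul _), integral_sub i1 i2, integral_const_mul,
      integral_add i5 i4, integral_sub i3 i2, integral_const_mul,
      integral_g_move g hgp σ hsσ i Φ hΦm C hΦC]
    have h1 : σ i - σ (i + 1) = β * m (i + 1) := by
      have := hσ (i + 1)
      rwa [show i + 1 - 1 = i by ring] at this
    rw [h1]
    have h2 := hDE i
    change exp (β * m (i + 1)) * G (i + 1) - G i
        + c i * ((∫ ω, (g (ω i) - 𝔟) * D i ω ∂P) - G i + 𝔟 * E) = _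
    linear_combination h2
  -- a large box
  obtain ⟨N, hN⟩ : ∃ N : ℕ, ∀ i ∈ s ∪ hm.toFinset, (i.natAbs : ℤ) < N := by
    refine ⟨(s ∪ hm.toFinset).sup (fun i => i.natAbs + 1), fun i hi => ?_⟩
    have := Finset.le_sup (f := fun i : ℤ => i.natAbs + 1) hi
    omega
  have hNs : ∀ i : ℤ, (N : ℤ) ≤ (i.natAbs : ℤ) → i ∉ s := fun i hi his => by
    have := hN i (Finset.mem_union_left _ his); omega
  have hNm : ∀ i : ℤ, (N : ℤ) ≤ (i.natAbs : ℤ) → m i = 0 := fun i hi => by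
    by_contra hmi
    have := hN i (Finset.mem_union_right _ (by simpa using hmi)); omega
  set a : ℤ := -(N : ℤ) with ha
  have haN : ∀ i : ℤ, i ∉ (Finset.range (2 * N)).image (fun k : ℕ => a + k) →
      (N : ℤ) ≤ (i.natAbs : ℤ) ∧ (N : ℤ) ≤ ((i + 1).natAbs : ℤ) := by
    intro i hi
    have h1 : i < a ∨ a + (2 * N : ℕ) ≤ i := by
      by_contra! hcon
      apply hi
      rw [Finset.mem_image]
      refine ⟨(i - a).toNat, ?_, ?_⟩
      · rw [Finset.mem_range]; omega
      · omega
    omega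
  have hinj : Set.InjOn (fun k : ℕ => a + (k : ℤ)) (Finset.range (2 * N)) := by
    intro k _ l _ hkl
    simp only at hkl
    omega
  have hL : ∀ x, LZ g φ x = ∑ k ∈ Finset.range (2 * N), t (a + k) x := by
    intro x
    have : LZ g φ x = ∑' i, t i x := rfl
    rw [this, tsum_eq_sum (s := (Finset.range (2 * N)).image (fun k : ℕ => a + (k : ℤ))),
      Finset.sum_image hinj]
    intro i hi
    obtain ⟨h1, h2⟩ := haN i hi
    have hi1 := hNs i h1
    have hi2 := hNs _ h2
    have hmv : ∀ (η : ConfZ), ∀ j ∈ s, moveZ η i (i + 1) j = η j := by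
      intro η j hj
      unfold moveZ
      rw [if_neg (by rintro rfl; exact hi1 hj), if_neg (by rintro rfl; exact hi2 hj)]
    simp only [ht]
    rw [hs (moveZ x.1 i (i + 1), moveZ x.2 i (i + 1)) x (fun j hj => ⟨hmv _ j hj, hmv _ j hj⟩),
      hs (x.1, moveZ x.2 i (i + 1)) x (fun j hj => ⟨rfl, hmv _ j hj⟩)]
    ring
  -- values far away
  have hGfar : ∀ i : ℤ, (N : ℤ) ≤ (i.natAbs : ℤ) → G i = exp (σ i) * E := by
    intro i hi
    simp only [hG]
    rw [(integral_g g hgp σ hsσ i Φ hΦm C hΦC).2]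
    congr 1
    refine integral_congr_ae (Eventually.of_forall fun ω => ?_)
    apply hs
    intro j hj
    have : j ≠ i := by rintro rfl; exact hNs _ hi hj
    simp [emb, addAt, this]
  have hLHS : ∫ x, LZ g φ x ∂(ν σ m) = ∑ k ∈ Finset.range (2 * N),
      (exp (β * m (a + k + 1)) * G (a + k + 1) - G (a + k)
        + c (a + k) * ((exp (σ (a + k)) - 𝔟) * EE (a + k) - G (a + k) + 𝔟 * E)) := by
    simp only [hL]
    rw [hνP, integral_map (measurable_emb m).aemeasurable
      (Finset.measurable_sum _ fun k _ => htm _).aestronglyMeasurable,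
      integral_finsetSum _ fun k _ => (hint _).1]
    exact Finset.sum_congr rfl fun k _ => (hint _).2
  have hRHS : ∑' i : ℤ, (exp (β * m i) - 1) * (exp (σ i) - 𝔟) *
          ((∫ x, φ x ∂(ν (Function.update σ i (σ i + β)) (moveM m i (i + 1))))
            - ∫ x, φ x ∂(ν σ m))
      = ∑ k ∈ Finset.range (2 * N), c (a + k) * (exp (σ (a + k)) - 𝔟) * (EE (a + k) - E) := by
    rw [hEν, tsum_eq_sum (s := (Finset.range (2 * N)).image (fun k : ℕ => a + (k : ℤ))),
      Finset.sum_image hinj]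
    intro i hi
    rw [hNm i (haN i hi).1]
    simp
  rw [hLHS, hRHS]
  -- telescoping
  have tel1 := Finset.sum_range_sub
    (fun k : ℕ => exp (β * m (a + k)) * G (a + k) - exp (σ (a + k - 1)) * E) (2 * N)
  have hcσ : ∀ i, exp (σ (i - 1)) = exp (β * m i) * exp (σ i) := fun i => by
    rw [← exp_add, ← hσ i]; congr 1; ring
  have e1 : exp (β * m (a + (2 * N : ℕ))) * G (a + (2 * N : ℕ))
      - exp (σ (a + (2 * N : ℕ) - 1)) * E = 0 := by
    rw [hcσ, hGfar _ (by omega)]; ring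
  have e2 : exp (β * m (a + (0 : ℕ))) * G (a + (0 : ℕ)) - exp (σ (a + (0 : ℕ) - 1)) * E = 0 := by
    rw [hcσ, hGfar _ (by omega)]; ring
  rw [e1, e2, sub_zero] at tel1
  rw [← sub_eq_zero, ← Finset.sum_sub_distrib, ← tel1]
  refine Finset.sum_congr rfl fun k _ => ?_
  have e3 : a + ((k + 1 : ℕ) : ℤ) = a + k + 1 := by push_cast; ring
  have e4 : a + (k : ℤ) + 1 - 1 = a + k := by ring
  rw [e3, e4, hcσ (a + k)]
  simp only [hc]
  ring
end

section
/- Let g(y) = 𝔞·(e^{βy} − 1) on ℕ with 𝔞, β > 0 and p = 1. Let m: ℤ → ℕ be finitely supported and σ: ℤ → ℝ satisfy σ_{i−1} − σ_i = β·m_i for all i ∈ ℤ. Then for every bounded cylinder function φ: ∫Lφ dν^{σ,m} = Σ_{i∈ℤ} (e^{β m_i} − 1)·(e^{σ_i} + 𝔞)·[∫φ dν^{σ^{(i)}, m^{i,i+1}} − ∫φ dν^{σ,m}], where m^{i,i+1} denotes m with m_i decreased by 1 and m_{i+1} increased by 1, and σ^{(i)} agrees with σ except that σ^{(i)}_i =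 σ_i + β. (The sum is effectively finite since terms with m_i = 0 vanish.) -/
open MeasureTheory Real

noncomputable def gfact (g : ℕ → ℝ) (z : ℕ) : ℝ := ∏ y ∈ Finset.Icc 1 z, g y

noncomputable def ZN (g : ℕ → ℝ) (θ : ℝ) : ℝ := ∑' z : ℕ, exp (θ * z) / gfact g z

noncomputable def muN (g : ℕ → ℝ) (θ : ℝ) (z : ℕ) : ℝ := exp (θ * z) / (gfact g z * ZN g θ)

abbrev ConfN : Type := ℤ → ℕ

/-- The configuration with one particle moved from site `i` to site `j`. -/
def moveN (η : ConfN) (i j : ℤ) : ConfN :=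
  fun k => if k = i then η k - 1 else if k = j then η k + 1 else η k

/-- The coupled zero range generator with right-jump probability `p` and rate function `g`,
acting on functions of the coupled pair of configurations. -/
noncomputable def LN (p : ℝ) (g : ℕ → ℝ) (φ : ConfN × ConfN → ℝ) (x : ConfN × ConfN) : ℝ :=
  ∑' i : ℤ,
    (p * g (x.1 i) * (φ (moveN x.1 i (i + 1), moveN x.2 i (i + 1)) - φ x)
      + p * (g (x.2 i) - g (x.1 i)) * (φ (x.1, moveN x.2 i (i + 1)) - φ x)
      + (1 - p) * g (x.1 i) * (φ (moveN x.1 i (i - 1), moveN x.2 i (i - 1)) - φ x)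
      + (1 - p) * (g (x.2 i) - g (x.1 i)) * (φ (x.1, moveN x.2 i (i - 1)) - φ x))

/-- A bounded cylinder function: bounded and depending on finitely many coordinates. -/
def IsBddCylinder (φ : ConfN × ConfN → ℝ) : Prop :=
  (∃ s : Finset ℤ, ∀ x y : ConfN × ConfN,
      (∀ i ∈ s, x.1 i = y.1 i ∧ x.2 i = y.2 i) → φ x = φ y)
    ∧ ∃ C : ℝ, ∀ x, |φ x| ≤ C

/-- The discrete measure on ℕ × ℕ with mass function `f`. -/
noncomputable def siteMeasure (f : ℕ × ℕ → ℝ) : Measure (ℕ × ℕ) :=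
  Measure.count.withDensity fun yz => ENNReal.ofReal (f yz)

/-- `ν` is the product measure on `(ℕ × ℕ)^ℤ` with the given site marginals:
every cylinder event has product probability. -/
def IsProductMeasure (fac : ℤ → Measure (ℕ × ℕ)) (ν : Measure (ConfN × ConfN)) : Prop :=
  ∀ (s : Finset ℤ) (B : ℤ → Set (ℕ × ℕ)),
    ν {x : ConfN × ConfN | ∀ i ∈ s, (x.1 i, x.2 i) ∈ B i} = ∏ i ∈ s, fac i (B i)

/-- The site marginals of the multi-shock measure `ν^{σ,m}`: at site `i`, the image of
`μ^{σ_i}` under `y ↦ (y, y + m_i)`. -/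
noncomputable def multiFactor (g : ℕ → ℝ) (σ : ℤ → ℝ) (m : ℤ → ℕ) (i : ℤ) :
    Measure (ℕ × ℕ) :=
  siteMeasure fun yz => if yz.2 = yz.1 + m i then muN g (σ i) yz.1 else 0

namespace RWS

section one
variable {𝔞 β : ℝ} {g : ℕ → ℝ}

lemma g_zero (hg : ∀ y : ℕ, g y = 𝔞 * (exp (β * y) - 1)) : g 0 = 0 := by simp [hg]

lemma g_pos (h𝔞 : 0 < 𝔞) (hβ : 0 < β) (hg : ∀ y : ℕ, g y = 𝔞 * (exp (β * y) - 1))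
    (y : ℕ) : 0 < g (y + 1) := by
  rw [hg]
  apply mul_pos h𝔞
  rw [sub_pos, Real.one_lt_exp_iff]
  positivity

lemma g_nonneg (h𝔞 : 0 < 𝔞) (hβ : 0 < β) (hg : ∀ y : ℕ, g y = 𝔞 * (exp (β * y) - 1))
    (y : ℕ) : 0 ≤ g y := by
  cases y with
  | zero => exact (g_zero hg).ge
  | succ y => exact (g_pos h𝔞 hβ hg y).le

lemma gfact_succ (z : ℕ) : gfact g (z + 1) = gfact g z * g (z + 1) := by
  unfold gfact
  rw [Finset.prod_Icc_succ_top (by omega)]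

lemma gfact_pos (hp : ∀ y, 0 < g (y + 1)) (z : ℕ) : 0 < gfact g z := by
  induction z with
  | zero => simp [gfact]
  | succ z ih => rw [gfact_succ]; exact mul_pos ih (hp z)

lemma term_succ (hp : ∀ y, 0 < g (y + 1)) (θ : ℝ) (z : ℕ) :
    g (z + 1) * (exp (θ * ((z + 1 : ℕ) : ℝ)) / gfact g (z + 1))
      = exp θ * (exp (θ * z) / gfact g z) := by
  have h1 := (hp z).ne'
  have h2 := (gfact_pos hp z).ne'
  rw [gfact_succ]
  have : exp (θ * ((z + 1 : ℕ) : ℝ)) = exp θ * exp (θ * z) := by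
    rw [← Real.exp_add]; congr 1; push_cast; ring
  rw [this]
  field_simp

lemma summ (h𝔞 : 0 < 𝔞) (hβ : 0 < β) (hg : ∀ y : ℕ, g y = 𝔞 * (exp (β * y) - 1)) (θ : ℝ) :
    Summable (fun z : ℕ => exp (θ * z) / gfact g z) := by
  have hp := g_pos h𝔞 hβ hg
  have pos : ∀ z : ℕ, 0 < exp (θ * z) / gfact g z := fun z =>
    div_pos (exp_pos _) (gfact_pos hp z)
  apply summable_of_ratio_test_tendsto_lt_one (l := 0) one_pos
  · exact Filter.Eventually.of_forall fun z => (pos z).ne'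
  · have hgt : Filter.Tendsto (fun z : ℕ => g (z + 1)) Filter.atTop Filter.atTop := by
      have : Filter.Tendsto g Filter.atTop Filter.atTop := by
        have e : g = fun y : ℕ => 𝔞 * (exp (β * y) - 1) := funext hg
        rw [e]
        apply Filter.Tendsto.const_mul_atTop h𝔞
        apply Filter.tendsto_atTop_add_const_right
        apply Real.tendsto_exp_atTop.comp
        exact Filter.Tendsto.const_mul_atTop hβ tendsto_natCast_atTop_atTop
      exact this.comp (Filter.tendsto_add_atTop_nat 1)
    have := (Filter.Tendsto.const_div_atTop hgt (exp θ))
    refine this.congr fun z => ?_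
    rw [Real.norm_of_nonneg (pos _).le, Real.norm_of_nonneg (pos _).le]
    have h := term_succ hp θ z
    rw [eq_div_iff (pos z).ne', div_mul_eq_mul_div, div_eq_iff (hp z).ne']
    linarith

lemma ZN_pos (h𝔞 : 0 < 𝔞) (hβ : 0 < β) (hg : ∀ y : ℕ, g y = 𝔞 * (exp (β * y) - 1)) (θ : ℝ) :
    0 < ZN g θ :=
  (summ h𝔞 hβ hg θ).tsum_pos (fun z => (div_pos (exp_pos _) (gfact_pos (g_pos h𝔞 hβ hg) z)).le) 0
    (div_pos (exp_pos _) (gfact_pos (g_pos h𝔞 hβ hg) 0))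

lemma muN_eq (θ : ℝ) (z : ℕ) : muN g θ z = exp (θ * z) / gfact g z / ZN g θ := by
  rw [muN, div_div]

lemma muN_nonneg (h𝔞 : 0 < 𝔞) (hβ : 0 < β) (hg : ∀ y : ℕ, g y = 𝔞 * (exp (β * y) - 1)) (θ : ℝ)
    (z : ℕ) : 0 ≤ muN g θ z := by
  rw [muN_eq]
  exact (div_pos (div_pos (exp_pos _) (gfact_pos (g_pos h𝔞 hβ hg) z)) (ZN_pos h𝔞 hβ hg θ)).le

lemma muN_succ (h𝔞 : 0 < 𝔞) (hβ : 0 < β) (hg : ∀ y : ℕ, g y = 𝔞 * (exp (β * y) - 1)) (θ : ℝ)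
    (z : ℕ) : g (z + 1) * muN g θ (z + 1) = exp θ * muN g θ z := by
  rw [muN_eq, muN_eq, ← mul_div_assoc, term_succ (g_pos h𝔞 hβ hg), mul_div_assoc]

lemma ZN_shift (h𝔞 : 0 < 𝔞) (hβ : 0 < β) (hg : ∀ y : ℕ, g y = 𝔞 * (exp (β * y) - 1)) (θ : ℝ) :
    𝔞 * ZN g (θ + β) = (exp θ + 𝔞) * ZN g θ := by
  have hp := g_pos h𝔞 hβ hg
  have hs := summ h𝔞 hβ hg θ
  have hs1 : Summable (fun z : ℕ => g z * (exp (θ * z) / gfact g z)) := by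
    rw [← summable_nat_add_iff 1]
    simp_rw [term_succ hp]
    exact hs.mul_left _
  have h1 : ∑' z : ℕ, g z * (exp (θ * z) / gfact g z) = exp θ * ZN g θ := by
    rw [hs1.tsum_eq_zero_add, g_zero hg, zero_mul, zero_add]
    simp_rw [term_succ hp]
    rw [tsum_mul_left]; rfl
  unfold ZN at *
  rw [add_mul, ← h1, ← tsum_mul_left, ← tsum_mul_left, ← hs1.tsum_add (hs.mul_left _)]
  congr 1
  ext z
  have : exp ((θ + β) * z) = exp (θ * z) * exp (β * z) := by
    rw [← Real.exp_add]; congr 1; ring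
  rw [this, hg]
  ring

lemma muN_tilt (h𝔞 : 0 < 𝔞) (hβ : 0 < β) (hg : ∀ y : ℕ, g y = 𝔞 * (exp (β * y) - 1)) (θ : ℝ)
    (z : ℕ) : (g z + 𝔞) * muN g θ z = (exp θ + 𝔞) * muN g (θ + β) z := by
  have h := ZN_shift h𝔞 hβ hg θ
  have h1 := (ZN_pos h𝔞 hβ hg θ).ne'
  have h2 := (ZN_pos h𝔞 hβ hg (θ + β)).ne'
  have h3 := (gfact_pos (g_pos h𝔞 hβ hg) z).ne'
  have : exp ((θ + β) * z) = exp (θ * z) * exp (β * z) := by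
    rw [← Real.exp_add]; congr 1; ring
  rw [muN, muN, this, hg]
  field_simp
  linear_combination exp (β * z) * h

/-- One-site marginal as a measure on `ℕ`. -/
noncomputable def M (g : ℕ → ℝ) (θ : ℝ) : Measure ℕ :=
  Measure.count.withDensity fun y => ENNReal.ofReal (muN g θ y)

lemma M_singleton (θ : ℝ) (y : ℕ) : M g θ {y} = ENNReal.ofReal (muN g θ y) := by
  rw [M, withDensity_apply _ (measurableSet_singleton y), lintegral_singleton]
  simp

lemma M_prob (h𝔞 : 0 < 𝔞) (hβ : 0 < β) (hg : ∀ y : ℕ, g y = 𝔞 * (exp (β * y) - 1)) (θ : ℝ) :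
    IsProbabilityMeasure (M g θ) := by
  constructor
  have e : ∀ z, muN g θ z = exp (θ * z) / gfact g z / ZN g θ := muN_eq θ
  have hs : Summable (muN g θ) := by
    rw [funext e]; exact (summ h𝔞 hβ hg θ).div_const _
  rw [M, withDensity_apply _ MeasurableSet.univ, Measure.restrict_univ, lintegral_count,
    ← ENNReal.ofReal_tsum_of_nonneg (muN_nonneg h𝔞 hβ hg θ) hs]
  have : ∑' z, muN g θ z = 1 := by
    simp_rw [e]
    rw [tsum_div_const]
    exact div_self (ZN_pos h𝔞 hβ hg θ).ne'
  rw [this]; simp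

lemma M_wd_singleton (θ : ℝ) (w : ℕ → ENNReal) (y : ℕ) :
    (M g θ).withDensity w {y} = w y * ENNReal.ofReal (muN g θ y) := by
  rw [withDensity_apply _ (measurableSet_singleton y), lintegral_singleton, M_singleton]

lemma M_shift (h𝔞 : 0 < 𝔞) (hβ : 0 < β) (hg : ∀ y : ℕ, g y = 𝔞 * (exp (β * y) - 1)) (θ : ℝ) :
    (M g θ).withDensity (fun y => ENNReal.ofReal (exp (-θ) * g y)) = (M g θ).map (· + 1) := by
  rw [Measure.ext_iff_singleton]
  intro y
  rw [M_wd_singleton, Measure.map_apply (measurable_of_countable _) (measurableSet_singleton y)]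
  cases y with
  | zero =>
    have : (fun y : ℕ => y + 1) ⁻¹' {0} = ∅ := by ext; simp
    rw [this, g_zero hg]; simp
  | succ y =>
    have : (fun y : ℕ => y + 1) ⁻¹' {y + 1} = {y} := by ext; simp
    rw [this, M_singleton, ← ENNReal.ofReal_mul (mul_nonneg (exp_pos _).le (g_pos h𝔞 hβ hg y).le),
      mul_assoc, muN_succ h𝔞 hβ hg, ← mul_assoc, ← Real.exp_add]
    simp

lemma M_tilt (h𝔞 : 0 < 𝔞) (hβ : 0 < β) (hg : ∀ y : ℕ, g y = 𝔞 * (exp (β * y) - 1)) (θ : ℝ) :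
    (M g θ).withDensity (fun y => ENNReal.ofReal ((g y + 𝔞) / (exp θ + 𝔞))) = M g (θ + β) := by
  rw [Measure.ext_iff_singleton]
  intro y
  have hpos : 0 < exp θ + 𝔞 := add_pos (exp_pos _) h𝔞
  rw [M_wd_singleton, M_singleton, ← ENNReal.ofReal_mul
    (div_nonneg (add_nonneg (g_nonneg h𝔞 hβ hg y) h𝔞.le) hpos.le), div_mul_eq_mul_div,
    muN_tilt h𝔞 hβ hg, mul_div_cancel_left₀ _ hpos.ne']

lemma map_wd {α γ : Type*} [MeasurableSpace α] [MeasurableSpace γ] (μ : Measure α) (f : α → γ)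
    (hf : Measurable f) (w : γ → ENNReal) (hw : Measurable w) :
    (μ.map f).withDensity w = (μ.withDensity (w ∘ f)).map f := by
  ext s hs
  rw [withDensity_apply _ hs, setLIntegral_map hs hw hf, Measure.map_apply hf hs,
    withDensity_apply _ (hf hs)]
  rfl

lemma fac_eq (σ : ℤ → ℝ) (m : ℤ → ℕ) (i : ℤ) :
    multiFactor g σ m i = (M g (σ i)).map (fun y => (y, y + m i)) := by
  rw [Measure.ext_iff_singleton]
  rintro ⟨y, z⟩
  rw [multiFactor, siteMeasure, withDensity_apply _ (measurableSet_singleton _),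
    lintegral_singleton, Measure.map_apply (measurable_of_countable _) (measurableSet_singleton _)]
  simp only [Measure.count_singleton, mul_one]
  split_ifs with h
  · have : (fun y : ℕ => (y, y + m i)) ⁻¹' {(y, z)} = {y} := by
      ext a; simp; intro ha; subst ha; exact h.symm
    rw [this, M_singleton]
  · have : (fun y : ℕ => (y, y + m i)) ⁻¹' {(y, z)} = ∅ := by
      ext a; simp; intro ha; subst ha; exact fun h' => h h'.symm
    rw [this]; simp

lemma fac_prob (h𝔞 : 0 < 𝔞) (hβ : 0 < β) (hg : ∀ y : ℕ, g y = 𝔞 * (exp (β * y) - 1))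
    (σ : ℤ → ℝ) (m : ℤ → ℕ) (i : ℤ) : IsProbabilityMeasure (multiFactor g σ m i) := by
  have := M_prob h𝔞 hβ hg (σ i)
  rw [fac_eq]
  exact Measure.isProbabilityMeasure_map (measurable_of_countable _).aemeasurable

lemma fac_shift (h𝔞 : 0 < 𝔞) (hβ : 0 < β) (hg : ∀ y : ℕ, g y = 𝔞 * (exp (β * y) - 1))
    (σ : ℤ → ℝ) (m : ℤ → ℕ) (i : ℤ) :
    (multiFactor g σ m i).withDensity (fun q => ENNReal.ofReal (exp (-σ i) * g q.1))
      = (multiFactor g σ m i).map (fun q => (q.1 + 1, q.2 + 1)) := by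
  rw [fac_eq, map_wd _ _ (measurable_of_countable _) _ (measurable_of_countable _),
    Measure.map_map (measurable_of_countable _) (measurable_of_countable _)]
  have := M_shift h𝔞 hβ hg (σ i)
  have e : ((fun q : ℕ × ℕ => ENNReal.ofReal (exp (-σ i) * g q.1)) ∘ fun y => (y, y + m i))
    = (fun y => ENNReal.ofReal (exp (-σ i) * g y)) := rfl
  rw [e, this, Measure.map_map (measurable_of_countable _) (measurable_of_countable _)]
  congr 1
  ext y <;> simp; omega

lemma fac_tilt (h𝔞 : 0 < 𝔞) (hβ : 0 < β) (hg : ∀ y : ℕ, g y = 𝔞 * (exp (β * y) - 1))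
    (σ : ℤ → ℝ) (m : ℤ → ℕ) (i : ℤ) (hmi : m i ≠ 0) :
    ((multiFactor g σ m i).withDensity
      (fun q => ENNReal.ofReal ((g q.1 + 𝔞) / (exp (σ i) + 𝔞)))).map (fun q => (q.1, q.2 - 1))
      = (M g (σ i + β)).map (fun y => (y, y + (m i - 1))) := by
  rw [fac_eq, map_wd _ _ (measurable_of_countable _) _ (measurable_of_countable _)]
  have e : ((fun q : ℕ × ℕ => ENNReal.ofReal ((g q.1 + 𝔞) / (exp (σ i) + 𝔞)))
      ∘ fun y => (y, y + m i))
    = (fun y => ENNReal.ofReal ((g y + 𝔞) / (exp (σ i) + 𝔞))) := rfl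
  rw [e, M_tilt h𝔞 hβ hg, Measure.map_map (measurable_of_countable _) (measurable_of_countable _)]
  congr 1
  ext y <;> simp; omega

end one
section prod

/-- The pair of values at site `i`. -/
def pr (i : ℤ) (x : ConfN × ConfN) : ℕ × ℕ := (x.1 i, x.2 i)

lemma pr_meas (i : ℤ) : Measurable (pr i) := by
  unfold pr; fun_prop

lemma cyl_meas (s : Finset ℤ) (B : ℤ → Set (ℕ × ℕ)) :
    MeasurableSet {x : ConfN × ConfN | ∀ i ∈ s, (x.1 i, x.2 i) ∈ B i} := by
  have : {x : ConfN × ConfN | ∀ i ∈ s, (x.1 i, x.2 i) ∈ B i} = ⋂ i ∈ s, pr i ⁻¹' B i := by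
    ext x; simp [pr]
  rw [this]
  exact Finset.measurableSet_biInter s fun i _ => pr_meas i (Set.to_countable _).measurableSet

/-- Apply a map at every site. -/
def siteMap (T : ℤ → ℕ × ℕ → ℕ × ℕ) (x : ConfN × ConfN) : ConfN × ConfN :=
  (fun j => (T j (pr j x)).1, fun j => (T j (pr j x)).2)

lemma siteMap_meas (T : ℤ → ℕ × ℕ → ℕ × ℕ) : Measurable (siteMap T) := by
  unfold siteMap
  refine Measurable.prodMk (measurable_pi_lambda _ fun j => ?_) (measurable_pi_lambda _ fun j => ?_)
  · exact (measurable_of_countable (fun q => (T j q).1)).comp (pr_meas j)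
  · exact (measurable_of_countable (fun q => (T j q).2)).comp (pr_meas j)

variable {fac fac' : ℤ → Measure (ℕ × ℕ)} {ν ν' : Measure (ConfN × ConfN)}

lemma prod_map (h : IsProductMeasure fac ν) (T : ℤ → ℕ × ℕ → ℕ × ℕ) :
    IsProductMeasure (fun j => (fac j).map (T j)) (ν.map (siteMap T)) := by
  intro s B
  rw [Measure.map_apply (siteMap_meas T) (cyl_meas s B)]
  have := h s (fun j => T j ⁻¹' B j)
  simp_rw [Measure.map_apply (measurable_of_countable (T _)) (Set.to_countable (B _)).measurableSet]
  rw [← this]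
  rfl

lemma prod_tilt (h : IsProductMeasure fac ν) (i : ℤ) (w : ℕ × ℕ → ENNReal)
    (hw : (fac i).withDensity w Set.univ = 1) :
    IsProductMeasure (fun j => if j = i then (fac i).withDensity w else fac j)
      (ν.withDensity fun x => w (pr i x)) := by
  intro s B
  set Q : Set (ConfN × ConfN) := {x | ∀ j ∈ s.erase i, (x.1 j, x.2 j) ∈ B j} with hQ
  set C := ∏ j ∈ s.erase i, fac j (B j) with hC
  have mA : ∀ A : Set (ℕ × ℕ), MeasurableSet A := fun A => (Set.to_countable _).measurableSet
  have hmap : (ν.restrict Q).map (pr i) = C • fac i := by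
    ext A _
    rw [Measure.map_apply (pr_meas i) (mA A), Measure.restrict_apply (pr_meas i (mA A)),
      Measure.smul_apply, smul_eq_mul]
    have h1 := h (insert i (s.erase i)) (Function.update B i A)
    rw [Finset.prod_insert (Finset.notMem_erase i s), Function.update_self] at h1
    have h2 : ∏ j ∈ s.erase i, fac j (Function.update B i A j) = C := by
      apply Finset.prod_congr rfl
      intro j hj
      rw [Function.update_of_ne (Finset.ne_of_mem_erase hj)]
    rw [h2, mul_comm] at h1
    rw [← h1]
    congr 1
    ext x
    simp only [Set.mem_inter_iff, Set.mem_preimage, hQ, Set.mem_ofPred_eq, Finset.forall_mem_insert,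
      Function.update_self, pr]
    refine and_congr Iff.rfl (forall₂_congr fun j hj => ?_)
    rw [Function.update_of_ne (Finset.ne_of_mem_erase hj)]
  set b : Set (ℕ × ℕ) := if i ∈ s then B i else Set.univ with hb
  have hset : {x : ConfN × ConfN | ∀ j ∈ s, (x.1 j, x.2 j) ∈ B j} = pr i ⁻¹' b ∩ Q := by
    ext x
    simp only [Set.mem_inter_iff, Set.mem_preimage, hQ, Set.mem_ofPred_eq, hb, pr, Finset.mem_erase]
    constructor
    · intro hx
      refine ⟨?_, fun j hj => hx j hj.2⟩
      split_ifs with hi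
      · exact hx i hi
      · trivial
    · rintro ⟨h1, h2⟩ j hj
      by_cases hji : j = i
      · subst hji; rw [if_pos hj] at h1; exact h1
      · exact h2 j ⟨hji, hj⟩
  have key : (ν.withDensity fun x => w (pr i x)) (pr i ⁻¹' b ∩ Q)
      = C * (fac i).withDensity w b := by
    rw [withDensity_apply _ ((pr_meas i (mA b)).inter (cyl_meas _ _)),
      ← Measure.restrict_restrict (pr_meas i (mA b)),
      ← setLIntegral_map (mA b) (measurable_of_countable w) (pr_meas i), hmap,
      Measure.restrict_smul, lintegral_smul_measure, withDensity_apply _ (mA b), smul_eq_mul]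
  rw [hset, key]
  have hC' : ∏ j ∈ s.erase i, (if j = i then (fac i).withDensity w else fac j) (B j) = C := by
    apply Finset.prod_congr rfl
    intro j hj
    rw [if_neg (Finset.ne_of_mem_erase hj)]
  by_cases hi : i ∈ s
  · rw [← Finset.mul_prod_erase s _ hi, hC', hb, if_pos hi, mul_comm]
    simp only [if_true]
  · rw [hb, if_neg hi, hw, mul_one, ← hC', Finset.erase_eq_of_notMem hi]

lemma prod_unique (hp : ∀ j, IsProbabilityMeasure (fac j)) (h : IsProductMeasure fac ν)
    (h' : IsProductMeasure fac ν') : ν = ν' := by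
  set e : ConfN × ConfN → (ℤ → ℕ × ℕ) := fun x j => pr j x with he
  set d : (ℤ → ℕ × ℕ) → ConfN × ConfN := fun y => (fun j => (y j).1, fun j => (y j).2) with hd
  have me : Measurable e := measurable_pi_lambda _ fun j => pr_meas j
  have md : Measurable d := by fun_prop
  have key : ∀ ν : Measure (ConfN × ConfN), IsProductMeasure fac ν →
      ν = (Measure.infinitePi fac).map d := by
    intro ν h
    have : ν.map e = Measure.infinitePi fac := by
      apply Measure.eq_infinitePi
      intro s t ht
      rw [Measure.map_apply me (MeasurableSet.pi s.countable_toSet fun i _ => ht i), ← h s t]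
      rfl
    rw [← this, Measure.map_map md me]
    exact Measure.map_id.symm
  rw [key ν h, key ν' h']

lemma prod_prob (h : IsProductMeasure fac ν) : IsProbabilityMeasure ν := by
  constructor
  have := h ∅ (fun _ => Set.univ)
  simpa using this

lemma wd_int {w : ConfN × ConfN → ℝ} (mw : Measurable w) (w0 : ∀ x, 0 ≤ w x)
    (T : ConfN × ConfN → ConfN × ConfN) (mT : Measurable T)
    (h : (ν.withDensity fun x => ENNReal.ofReal (w x)).map T = ν')
    (φ : ConfN × ConfN → ℝ) (mφ : Measurable φ) :
    ∫ x, w x * φ (T x) ∂ν = ∫ x, φ x ∂ν' := by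
  rw [← h, integral_map mT.aemeasurable mφ.aestronglyMeasurable,
    integral_withDensity_eq_integral_toReal_smul (by fun_prop) (by simp)]
  congr 1
  ext x
  rw [ENNReal.toReal_ofReal (w0 x), smul_eq_mul]

lemma cyl_fun_meas (φ : ConfN × ConfN → ℝ) (s : Finset ℤ)
    (hs : ∀ x y : ConfN × ConfN, (∀ i ∈ s, x.1 i = y.1 i ∧ x.2 i = y.2 i) → φ x = φ y) :
    Measurable φ := by
  classical
  set e : ConfN × ConfN → (s → ℕ × ℕ) := fun x j => pr j x with he
  have me : Measurable e := measurable_pi_lambda _ fun j => pr_meas j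
  set d : (s → ℕ × ℕ) → ConfN × ConfN := fun y =>
    (fun j => if h : j ∈ s then (y ⟨j, h⟩).1 else 0, fun j => if h : j ∈ s then (y ⟨j, h⟩).2 else 0)
  have : φ = (φ ∘ d) ∘ e := by
    ext x
    apply hs
    intro i hi
    simp [d, e, hi, pr]
  rw [this]
  exact (measurable_of_countable _).comp me

end prod
section main
variable {𝔞 β : ℝ} {g : ℕ → ℝ} {σ : ℤ → ℝ} {m : ℤ → ℕ} {ν : Measure (ConfN × ConfN)}

/-- Both coordinates at site `i` raised by one. -/
def shiftT (i : ℤ) (j : ℤ) (q : ℕ × ℕ) : ℕ × ℕ := if j = i then (q.1 + 1, q.2 + 1) else q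

lemma wd_shift (h𝔞 : 0 < 𝔞) (hβ : 0 < β) (hg : ∀ y : ℕ, g y = 𝔞 * (exp (β * y) - 1))
    (h : IsProductMeasure (multiFactor g σ m) ν) (i : ℤ) :
    (ν.withDensity fun x => ENNReal.ofReal (exp (-σ i) * g (x.1 i)))
      = ν.map (siteMap (shiftT i)) := by
  have hp := fac_prob h𝔞 hβ hg σ m
  have hs := fac_shift h𝔞 hβ hg σ m i
  have hs1 : (multiFactor g σ m i).withDensity
      (fun q => ENNReal.ofReal (exp (-σ i) * g q.1)) Set.univ = 1 := by
    rw [hs, Measure.map_apply (measurable_of_countable _) MeasurableSet.univ]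
    simp
  have h1 := prod_tilt h i _ hs1
  have h2 := prod_map h (shiftT i)
  have e : (fun j => (multiFactor g σ m j).map (shiftT i j))
      = fun j => if j = i then (multiFactor g σ m i).withDensity
          (fun q => ENNReal.ofReal (exp (-σ i) * g q.1)) else multiFactor g σ m j := by
    ext1 j
    split_ifs with hj
    · subst hj
      rw [hs]
      congr 1
      ext q <;> simp [shiftT]
    · have : shiftT i j = id := by ext q <;> simp [shiftT, hj]
      rw [this, Measure.map_id]
  rw [← e] at h1
  exact prod_unique (fun j => Measure.isProbabilityMeasure_map
    (measurable_of_countable _).aemeasurable) h1 h2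

lemma moveN_meas (i j : ℤ) : Measurable (fun η : ConfN => moveN η i j) := by
  refine measurable_pi_lambda _ fun k => ?_
  unfold moveN
  split_ifs
  · exact (measurable_of_countable (fun n : ℕ => n - 1)).comp (measurable_pi_apply k)
  · exact (measurable_of_countable (fun n : ℕ => n + 1)).comp (measurable_pi_apply k)
  · exact measurable_pi_apply k

/-- Move both particles. -/
def moveBoth (i : ℤ) (x : ConfN × ConfN) : ConfN × ConfN :=
  (moveN x.1 i (i + 1), moveN x.2 i (i + 1))

/-- Move the second particle. -/
def moveSnd (i : ℤ) (x : ConfN × ConfN) : ConfN × ConfN := (x.1, moveN x.2 i (i + 1))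

lemma moveBoth_meas (i : ℤ) : Measurable (moveBoth i) :=
  ((moveN_meas i (i + 1)).comp measurable_fst).prodMk ((moveN_meas i (i + 1)).comp measurable_snd)

lemma moveSnd_meas (i : ℤ) : Measurable (moveSnd i) :=
  measurable_fst.prodMk ((moveN_meas i (i + 1)).comp measurable_snd)

lemma wd_move (h𝔞 : 0 < 𝔞) (hβ : 0 < β) (hg : ∀ y : ℕ, g y = 𝔞 * (exp (β * y) - 1))
    (h : IsProductMeasure (multiFactor g σ m) ν) (i : ℤ) :
    (ν.withDensity fun x => ENNReal.ofReal (exp (-σ i) * g (x.1 i))).map (moveBoth i)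
      = ν.withDensity fun x => ENNReal.ofReal (exp (-σ (i + 1)) * g (x.1 (i + 1))) := by
  rw [wd_shift h𝔞 hβ hg h, wd_shift h𝔞 hβ hg h,
    Measure.map_map (moveBoth_meas i) (siteMap_meas _)]
  congr 1
  ext x k <;> simp only [Function.comp, moveBoth, moveN, siteMap, shiftT, pr] <;>
    by_cases h1 : k = i <;> by_cases h2 : k = i + 1 <;> simp [h1, h2]

lemma wd_tilt (h𝔞 : 0 < 𝔞) (hβ : 0 < β) (hg : ∀ y : ℕ, g y = 𝔞 * (exp (β * y) - 1))
    (h : IsProductMeasure (multiFactor g σ m) ν) (i : ℤ) (hmi : m i ≠ 0)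
    {ν' : Measure (ConfN × ConfN)}
    (h' : IsProductMeasure (multiFactor g (Function.update σ i (σ i + β)) (moveN m i (i + 1))) ν') :
    (ν.withDensity fun x => ENNReal.ofReal ((g (x.1 i) + 𝔞) / (exp (σ i) + 𝔞))).map (moveSnd i)
      = ν' := by
  have hp := fac_prob h𝔞 hβ hg σ m
  have hp' := fac_prob h𝔞 hβ hg (Function.update σ i (σ i + β)) (moveN m i (i + 1))
  have hM := M_prob h𝔞 hβ hg (σ i + β)
  have ht := fac_tilt h𝔞 hβ hg σ m i hmi
  have ht1 : (multiFactor g σ m i).withDensity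
      (fun q => ENNReal.ofReal ((g q.1 + 𝔞) / (exp (σ i) + 𝔞))) Set.univ = 1 := by
    have := congrArg (fun μ : Measure (ℕ × ℕ) => μ Set.univ) ht
    beta_reduce at this
    rw [Measure.map_apply (measurable_of_countable _) MeasurableSet.univ,
      Measure.map_apply (measurable_of_countable _) MeasurableSet.univ] at this
    simpa using this
  set T : ℤ → ℕ × ℕ → ℕ × ℕ := fun j q => if j = i then (q.1, q.2 - 1) else
    if j = i + 1 then (q.1, q.2 + 1) else q with hT
  have h1 := prod_map (prod_tilt h i _ ht1) T
  have eT : siteMap T = moveSnd i := by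
    ext x k <;> simp only [moveSnd, moveN, siteMap, hT, pr] <;> split_ifs <;> rfl
  rw [eT] at h1
  refine prod_unique hp' ?_ h'
  have efac : multiFactor g (Function.update σ i (σ i + β)) (moveN m i (i + 1))
      = fun j => Measure.map (T j) (if j = i then (multiFactor g σ m i).withDensity
          (fun q => ENNReal.ofReal ((g q.1 + 𝔞) / (exp (σ i) + 𝔞))) else multiFactor g σ m j) := by
    ext1 j
    rw [fac_eq]
    by_cases hj : j = i
    · subst hj
      have : T j = fun q => (q.1, q.2 - 1) := by ext q <;> simp [hT]
      rw [this, if_pos rfl, ht]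
      simp [moveN]
    · rw [if_neg hj, Function.update_of_ne hj, fac_eq,
        Measure.map_map (measurable_of_countable _) (measurable_of_countable _)]
      congr 1
      ext q
      · simp only [Function.comp, hT, if_neg hj]; split_ifs <;> rfl
      · simp only [Function.comp, hT, if_neg hj, moveN]; split_ifs <;> simp; omega
  rw [efac]
  exact h1

lemma ae_pair (h : IsProductMeasure (multiFactor g σ m) ν) (i : ℤ) :
    ∀ᵐ x ∂ν, x.2 i = x.1 i + m i := by
  rw [ae_iff]
  have := h {i} (fun _ => {q | ¬ q.2 = q.1 + m i})
  simp only [Finset.mem_singleton, forall_eq, Finset.prod_singleton, Set.mem_ofPred_eq] at this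
  rw [this, fac_eq, Measure.map_apply (measurable_of_countable _)
    (Set.to_countable _).measurableSet]
  simp

lemma integrable_wg (h𝔞 : 0 < 𝔞) (hβ : 0 < β) (hg : ∀ y : ℕ, g y = 𝔞 * (exp (β * y) - 1))
    (h : IsProductMeasure (multiFactor g σ m) ν) (i : ℤ) (f : ConfN × ConfN → ℝ)
    (mf : Measurable f) (C : ℝ) (hC : ∀ x, |f x| ≤ C) :
    Integrable (fun x => g (x.1 i) * f x) ν := by
  have := prod_prob h
  have mg : Measurable (fun x : ConfN × ConfN => g (x.1 i)) :=
    (measurable_of_countable g).comp ((measurable_pi_apply i).comp measurable_fst)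
  have hi : Integrable (fun x : ConfN × ConfN => exp (-σ i) * g (x.1 i)) ν := by
    refine ⟨(mg.const_mul _).aestronglyMeasurable, ?_⟩
    rw [hasFiniteIntegral_iff_ofReal (ae_of_all _ fun x =>
      mul_nonneg (exp_pos _).le (g_nonneg h𝔞 hβ hg _))]
    have e := congrArg (fun μ : Measure (ConfN × ConfN) => μ Set.univ) (wd_shift h𝔞 hβ hg h i)
    beta_reduce at e
    rw [withDensity_apply _ MeasurableSet.univ, Measure.restrict_univ,
      Measure.map_apply (siteMap_meas _) MeasurableSet.univ] at e
    rw [e]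
    simp
  have hi' : Integrable (fun x : ConfN × ConfN => g (x.1 i)) ν := by
    have := hi.const_mul (exp (σ i))
    refine this.congr (ae_of_all _ fun x => ?_)
    simp only
    rw [← mul_assoc, ← Real.exp_add]; simp
  exact hi'.mul_bdd (c := C) mf.aestronglyMeasurable (ae_of_all _ hC)

lemma int_shift (h𝔞 : 0 < 𝔞) (hβ : 0 < β) (hg : ∀ y : ℕ, g y = 𝔞 * (exp (β * y) - 1))
    (h : IsProductMeasure (multiFactor g σ m) ν) (i : ℤ) (φ : ConfN × ConfN → ℝ)
    (mφ : Measurable φ) (hinv : ∀ x, φ (siteMap (shiftT i) x) = φ x) :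
    ∫ x, g (x.1 i) * φ x ∂ν = exp (σ i) * ∫ x, φ x ∂ν := by
  have mg : Measurable (fun x : ConfN × ConfN => exp (-σ i) * g (x.1 i)) :=
    ((measurable_of_countable g).comp ((measurable_pi_apply i).comp measurable_fst)).const_mul _
  have h1 := wd_int mg (fun x => mul_nonneg (exp_pos _).le (g_nonneg h𝔞 hβ hg _)) id measurable_id
    (Measure.map_id.trans (wd_shift h𝔞 hβ hg h i)) φ mφ
  rw [integral_map (siteMap_meas _).aemeasurable mφ.aestronglyMeasurable] at h1
  simp_rw [hinv, mul_assoc, integral_const_mul, id] at h1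
  rw [← h1, ← mul_assoc, ← Real.exp_add]
  simp

lemma int_move (h𝔞 : 0 < 𝔞) (hβ : 0 < β) (hg : ∀ y : ℕ, g y = 𝔞 * (exp (β * y) - 1))
    (h : IsProductMeasure (multiFactor g σ m) ν) (i : ℤ) (φ : ConfN × ConfN → ℝ)
    (mφ : Measurable φ) :
    ∫ x, g (x.1 i) * φ (moveBoth i x) ∂ν
      = exp (σ i) * (exp (-σ (i + 1)) * ∫ x, g (x.1 (i + 1)) * φ x ∂ν) := by
  have mg : ∀ i, Measurable (fun x : ConfN × ConfN => exp (-σ i) * g (x.1 i)) := fun i =>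
    ((measurable_of_countable g).comp ((measurable_pi_apply i).comp measurable_fst)).const_mul _
  have g0 : ∀ (i : ℤ) (x : ConfN × ConfN), 0 ≤ exp (-σ i) * g (x.1 i) := fun i x =>
    mul_nonneg (exp_pos _).le (g_nonneg h𝔞 hβ hg _)
  have h1 := wd_int (mg i) (g0 i) (moveBoth i) (moveBoth_meas i) (wd_move h𝔞 hβ hg h i) φ mφ
  have h2 := wd_int (ν := ν) (mg (i + 1)) (g0 (i + 1)) id measurable_id Measure.map_id φ mφ
  rw [← h2] at h1
  simp_rw [mul_assoc, integral_const_mul, id] at h1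
  rw [← h1, ← mul_assoc, ← Real.exp_add]
  simp

lemma int_tilt (h𝔞 : 0 < 𝔞) (hβ : 0 < β) (hg : ∀ y : ℕ, g y = 𝔞 * (exp (β * y) - 1))
    (h : IsProductMeasure (multiFactor g σ m) ν) (i : ℤ) (hmi : m i ≠ 0)
    {ν' : Measure (ConfN × ConfN)}
    (h' : IsProductMeasure (multiFactor g (Function.update σ i (σ i + β)) (moveN m i (i + 1))) ν')
    (φ : ConfN × ConfN → ℝ) (mφ : Measurable φ) :
    ∫ x, (g (x.1 i) + 𝔞) * φ (moveSnd i x) ∂ν = (exp (σ i) + 𝔞) * ∫ x, φ x ∂ν' := by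
  have hpos : 0 < exp (σ i) + 𝔞 := add_pos (exp_pos _) h𝔞
  have mg : Measurable (fun x : ConfN × ConfN => (g (x.1 i) + 𝔞) / (exp (σ i) + 𝔞)) :=
    (((measurable_of_countable g).comp
      ((measurable_pi_apply i).comp measurable_fst)).add_const _).div_const _
  have h1 := wd_int mg (fun x => div_nonneg (add_nonneg (g_nonneg h𝔞 hβ hg _) h𝔞.le) hpos.le)
    (moveSnd i) (moveSnd_meas i) (wd_tilt h𝔞 hβ hg h i hmi h') φ mφ
  rw [← h1, ← integral_const_mul]
  congr 1
  ext x
  field_simp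

lemma sum_tele (F : ℤ → ℝ) (s W : Finset ℤ) (hF : ∀ i, i ∉ s → F i = 0)
    (hW : ∀ i ∈ s, i ∈ W ∧ i - 1 ∈ W) : ∑ i ∈ W, (F (i + 1) - F i) = 0 := by
  rw [Finset.sum_sub_distrib, sub_eq_zero]
  have h1 : ∑ i ∈ W, F i = ∑ i ∈ s, F i :=
    (Finset.sum_subset (fun i hi => (hW i hi).1) fun i _ hi => hF i hi).symm
  have h2 : ∑ i ∈ W, F (i + 1) = ∑ i ∈ W.image (· + 1), F i := by
    rw [Finset.sum_image]
    intro a _ b _ hab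
    simpa using hab
  rw [h1, h2]
  refine (Finset.sum_subset (fun i hi => ?_) fun i _ hi => hF i hi).symm
  rw [Finset.mem_image]
  exact ⟨i - 1, (hW i hi).2, by ring⟩

lemma int_term (h𝔞 : 0 < 𝔞) (hβ : 0 < β) (hg : ∀ y : ℕ, g y = 𝔞 * (exp (β * y) - 1))
    (hσ : ∀ i : ℤ, σ (i - 1) - σ i = β * m i)
    (h : IsProductMeasure (multiFactor g σ m) ν) (i : ℤ)
    {ν' : Measure (ConfN × ConfN)}
    (h' : m i ≠ 0 →
      IsProductMeasure (multiFactor g (Function.update σ i (σ i + β)) (moveN m i (i + 1))) ν')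
    (φ : ConfN × ConfN → ℝ) (mφ : Measurable φ) (C : ℝ) (hC : ∀ x, |φ x| ≤ C) :
    Integrable (fun x => g (x.1 i) * (φ (moveBoth i x) - φ x)
        + (g (x.2 i) - g (x.1 i)) * (φ (moveSnd i x) - φ x)) ν ∧
    ∫ x, (g (x.1 i) * (φ (moveBoth i x) - φ x)
        + (g (x.2 i) - g (x.1 i)) * (φ (moveSnd i x) - φ x)) ∂ν
      = (exp (β * m i) - 1) * (exp (σ i) + 𝔞) * (∫ x, φ x ∂ν' - ∫ x, φ x ∂ν)
        + (exp (σ i) * (exp (-σ (i + 1)) * ∫ x, g (x.1 (i + 1)) * φ x ∂ν - ∫ x, φ x ∂ν)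
          - exp (σ (i - 1)) * (exp (-σ i) * ∫ x, g (x.1 i) * φ x ∂ν - ∫ x, φ x ∂ν)) := by
  have := prod_prob h
  set k := exp (β * m i) - 1 with hk
  have hae : (fun x : ConfN × ConfN => g (x.1 i) * (φ (moveBoth i x) - φ x)
        + (g (x.2 i) - g (x.1 i)) * (φ (moveSnd i x) - φ x)) =ᵐ[ν]
      fun x => (g (x.1 i) * φ (moveBoth i x) - g (x.1 i) * φ x)
        + k * ((g (x.1 i) + 𝔞) * φ (moveSnd i x) - (g (x.1 i) * φ x + 𝔞 * φ x)) := by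
    filter_upwards [ae_pair h i] with x hx
    have : g (x.2 i) - g (x.1 i) = k * (g (x.1 i) + 𝔞) := by
      rw [hx, hg, hg, hk]
      push_cast
      rw [mul_add, Real.exp_add]
      ring
    rw [this]
    ring
  have i1 := integrable_wg h𝔞 hβ hg h i _ (mφ.comp (moveBoth_meas i)) C (fun x => hC _)
  have i2 := integrable_wg h𝔞 hβ hg h i _ mφ C hC
  have i3 := integrable_wg h𝔞 hβ hg h i _ (mφ.comp (moveSnd_meas i)) C (fun x => hC _)
  have i4 : Integrable φ ν := Integrable.of_bound mφ.aestronglyMeasurable C (ae_of_all _ hC)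
  have i5 : Integrable (fun x => φ (moveSnd i x)) ν :=
    Integrable.of_bound (mφ.comp (moveSnd_meas i)).aestronglyMeasurable C (ae_of_all _ fun x => hC _)
  have i6 : Integrable (fun x => (g (x.1 i) + 𝔞) * φ (moveSnd i x)) ν := by
    simp_rw [add_mul]
    exact i3.add (i5.const_mul 𝔞)
  simp only [Function.comp] at i1
  have i7 : Integrable (fun x => g (x.1 i) * φ x + 𝔞 * φ x) ν := i2.add (i4.const_mul 𝔞)
  have i8 : Integrable (fun x => k * ((g (x.1 i) + 𝔞) * φ (moveSnd i x)
      - (g (x.1 i) * φ x + 𝔞 * φ x))) ν := (i6.sub i7).const_mul k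
  have i9 : Integrable (fun x => g (x.1 i) * φ (moveBoth i x) - g (x.1 i) * φ x) ν := i1.sub i2
  refine ⟨(i9.add i8).congr hae.symm, ?_⟩
  rw [integral_congr_ae hae]
  have e1 : ∫ x, ((g (x.1 i) * φ (moveBoth i x) - g (x.1 i) * φ x)
        + k * ((g (x.1 i) + 𝔞) * φ (moveSnd i x) - (g (x.1 i) * φ x + 𝔞 * φ x))) ∂ν
      = (∫ x, g (x.1 i) * φ (moveBoth i x) ∂ν - ∫ x, g (x.1 i) * φ x ∂ν)
        + k * (∫ x, (g (x.1 i) + 𝔞) * φ (moveSnd i x) ∂ν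
          - (∫ x, g (x.1 i) * φ x ∂ν + 𝔞 * ∫ x, φ x ∂ν)) := by
    rw [integral_add i9 i8, integral_sub i1 i2, integral_const_mul, integral_sub i6 i7,
      integral_add i2 (i4.const_mul 𝔞), integral_const_mul]
  rw [e1, int_move h𝔞 hβ hg h i φ mφ]
  have e2 : k * ∫ x, (g (x.1 i) + 𝔞) * φ (moveSnd i x) ∂ν
      = k * ((exp (σ i) + 𝔞) * ∫ x, φ x ∂ν') := by
    by_cases hmi : m i = 0
    · simp [hk, hmi]
    · rw [int_tilt h𝔞 hβ hg h i hmi (h' hmi) φ mφ]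
  have e3 : exp (σ (i - 1)) = (k + 1) * exp (σ i) := by
    rw [hk, sub_add_cancel, ← Real.exp_add, ← hσ i]; congr 1; ring
  have e4 : exp (σ i) * exp (-σ i) = 1 := by rw [← Real.exp_add]; simp
  rw [e3]
  linear_combination e2 + (-(k + 1) * (∫ x, g (x.1 i) * φ x ∂ν)) * (-e4)

end main

end RWS

/-- Theorem 2, case (iii): multiple random walking shocks in the convex exponential zero
range process on ℕ. The walker at site `i` jumps to `i + 1` with rate
`(e^{β m_i} - 1)·(e^{σ_i} + 𝔞)`, updating `m` by `m^{i,i+1}` and `σ_i` to `σ_i + β`. -/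
theorem rws_multi_exponential_ZRP
    (𝔞 β : ℝ) (h𝔞 : 0 < 𝔞) (hβ : 0 < β)
    (g : ℕ → ℝ) (hg : ∀ y : ℕ, g y = 𝔞 * (exp (β * y) - 1))
    (m : ℤ → ℕ) (hm : (Function.support m).Finite)
    (σ : ℤ → ℝ) (hσ : ∀ i : ℤ, σ (i - 1) - σ i = β * m i)
    (ν : (ℤ → ℝ) → (ℤ → ℕ) → Measure (ConfN × ConfN))
    (hν : ∀ (σ' : ℤ → ℝ) (m' : ℤ → ℕ), (Function.support m').Finite →
      (∀ i : ℤ, σ' (i - 1) - σ' i = β * m' i) →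
      IsProductMeasure (multiFactor g σ' m') (ν σ' m'))
    (φ : ConfN × ConfN → ℝ) (hφ : IsBddCylinder φ) :
    ∫ x, LN 1 g φ x ∂(ν σ m)
      = ∑' i : ℤ, (exp (β * m i) - 1) * (exp (σ i) + 𝔞) *
          ((∫ x, φ x ∂(ν (Function.update σ i (σ i + β)) (moveN m i (i + 1))))
            - ∫ x, φ x ∂(ν σ m)) := by
  obtain ⟨⟨s, hs⟩, C, hC⟩ := hφ
  have mφ := RWS.cyl_fun_meas φ s hs
  have h := hν σ m hm hσ
  have h' : ∀ i, m i ≠ 0 → IsProductMeasure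
      (multiFactor g (Function.update σ i (σ i + β)) (moveN m i (i + 1)))
      (ν (Function.update σ i (σ i + β)) (moveN m i (i + 1))) := by
    intro i hi
    apply hν
    · apply (hm.union (Set.finite_singleton (i + 1))).subset
      intro j hj
      by_contra hj'
      simp only [Set.mem_union, Function.mem_support, Set.mem_singleton_iff, not_or, not_not] at hj'
      apply hj
      simp [moveN, hj'.1, hj'.2]
    · intro j
      have := hσ j
      by_cases hj : j = i
      · subst hj
        rw [Function.update_self, Function.update_of_ne (by omega)]
        have e : moveN m j (j + 1) j = m j - 1 := by simp [moveN]
        rw [e, Nat.cast_sub (by omega)]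
        push_cast
        linarith
      · by_cases hj2 : j = i + 1
        · subst hj2
          rw [Function.update_of_ne hj, show i + 1 - 1 = i by ring, Function.update_self]
          rw [show i + 1 - 1 = i by ring] at this
          have e : moveN m i (i + 1) (i + 1) = m (i + 1) + 1 := by simp [moveN]
          rw [e]
          push_cast
          linarith
        · rw [Function.update_of_ne hj, Function.update_of_ne (by omega)]
          have e : moveN m i (i + 1) j = m j := by simp [moveN, hj, hj2]
          rw [e]
          exact this
  set W : Finset ℤ := s ∪ s.image (· - 1) ∪ hm.toFinset with hW
  have hWs : ∀ i ∈ s, i ∈ W ∧ i - 1 ∈ W := by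
    intro i hi
    constructor
    · simp [hW, hi]
    · simp only [hW, Finset.mem_union, Finset.mem_image]
      exact Or.inl (Or.inr ⟨i, hi, rfl⟩)
  have hL : ∀ x, LN 1 g φ x = ∑ i ∈ W, (g (x.1 i) * (φ (RWS.moveBoth i x) - φ x)
        + (g (x.2 i) - g (x.1 i)) * (φ (RWS.moveSnd i x) - φ x)) := by
    intro x
    unfold LN
    rw [tsum_eq_sum (s := W)]
    · apply Finset.sum_congr rfl
      intro i _
      simp only [RWS.moveBoth, RWS.moveSnd]
      ring
    · intro i hi
      have key : ∀ j ∈ s, j ≠ i ∧ j ≠ i + 1 := by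
        intro j hj
        have := hWs j hj
        constructor
        · rintro rfl; exact hi this.1
        · rintro rfl; apply hi; simpa using this.2
      have e1 : φ (moveN x.1 i (i + 1), moveN x.2 i (i + 1)) = φ x := by
        apply hs
        intro j hj
        simp [moveN, (key j hj).1, (key j hj).2]
      have e2 : φ (x.1, moveN x.2 i (i + 1)) = φ x := by
        apply hs
        intro j hj
        simp [moveN, (key j hj).1, (key j hj).2]
      rw [e1, e2]
      ring
  have ht := fun i => RWS.int_term h𝔞 hβ hg hσ h i (h' i) φ mφ C hC
  simp_rw [hL]
  rw [integral_finsetSum _ fun i _ => (ht i).1, tsum_eq_sum (s := W)]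
  · rw [Finset.sum_congr rfl fun i _ => (ht i).2, Finset.sum_add_distrib, add_eq_left]
    have := RWS.sum_tele (fun i => exp (σ (i - 1)) *
      (exp (-σ i) * ∫ x, g (x.1 i) * φ x ∂(ν σ m) - ∫ x, φ x ∂(ν σ m))) s W ?_ hWs
    · simpa only [add_sub_cancel_right] using this
    · intro i hi
      rw [RWS.int_shift h𝔞 hβ hg h i φ mφ, ← mul_assoc, ← Real.exp_add]
      · simp
      · intro x
        apply hs
        intro j hj
        have : j ≠ i := by rintro rfl; exact hi hj
        simp [RWS.siteMap, RWS.shiftT, RWS.pr, this]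
  · intro i hi
    have : m i = 0 := by
      by_contra hmi
      apply hi
      simp [hW, hmi]
    simp [this]
end
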